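/- arXiv:1009.3721 — 5 statements merged into one kernel-verified Lean document; each statement's English description precedes it below -/
import Mathlib

section
/- For every γ with 0 < γ < 1/2, every α with 0 < α < 1 satisfying 2γ = 1 − (1−w(α))(α+w(α)), every ε > 0 and every constant C > 0, there exist an integer n₀ and a real K such that the following holds. Let G be a (p,r)-pseudorandom directed graph on n ≥ n₀ vertices with r ≤ C√(np) and pn ≥ K. Then there exists a subgraph G' of G with at least (1/2+γ−ε)|E(G)| edges that contains no directed cycle of length greater than (1−α)·n. -/
/-- Number of edges of the digraph with edge set `E` directed from `A` to `B`. -/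
def eG {n : ℕ} (E : Finset (Fin n × Fin n)) (A B : Finset (Fin n)) : ℕ :=
  (E.filter fun e => e.1 ∈ A ∧ e.2 ∈ B).card

/-- A digraph on `n` vertices with edge set `E` is `(p,r)`-pseudorandom if it has
`p·n²` edges and for every two disjoint sets `A, B` with `|A| = |B|`, the number of
edges from `A` to `B` satisfies `|e(A,B) − p|A||B|| ≤ r·|A|·√(pn)`. -/
def Pseudorandom {n : ℕ} (E : Finset (Fin n × Fin n)) (p r : ℝ) : Prop :=
  (E.card : ℝ) = p * (n : ℝ) ^ 2 ∧
  ∀ A B : Finset (Fin n), Disjoint A B → A.card = B.card →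
    |(eG E A B : ℝ) - p * A.card * B.card| ≤ r * A.card * Real.sqrt (p * n)

/-- The digraph with edge set `E` has a directed cycle of length `ℓ`: a sequence of `ℓ`
distinct vertices, each with an edge to the next, cyclically. -/
def HasDirCycle {n : ℕ} (E : Finset (Fin n × Fin n)) (ℓ : ℕ) : Prop :=
  ∃ v : Fin ℓ → Fin n, Function.Injective v ∧
    ∀ i : Fin ℓ, (v i, v ⟨(i.val + 1) % ℓ, Nat.mod_lt _ i.pos⟩) ∈ E

/-- `w(α) = 1 − (1−α)·⌊(1−α)⁻¹⌋`. -/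
noncomputable def w (α : ℝ) : ℝ := 1 - (1 - α) * (⌊(1 - α)⁻¹⌋ : ℝ)

open Finset

/-- Averaging over all permutations of the vertices: some permutation `σ` pulls the relation `R`
back to one containing at least the average proportion of the edges of a loopless digraph. -/
lemma exists_perm_card_filter_ge {V : Type*} [Fintype V] [DecidableEq V]
    (R : V → V → Prop) [DecidableRel R] (E : Finset (V × V)) (hE : ∀ e ∈ E, e.1 ≠ e.2) :
    ∃ σ : Equiv.Perm V,
      #{e ∈ (univ : Finset V).offDiag | R e.1 e.2} * #E ≤
        #(univ : Finset V).offDiag * #{e ∈ E | R (σ e.1) (σ e.2)} := by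
  set D := (univ : Finset V).offDiag with hD
  set f : V × V → ℕ := fun e => #{σ : Equiv.Perm V | R (σ e.1) (σ e.2)} with hf
  have double_count : ∀ F : Finset (V × V),
      ∑ σ : Equiv.Perm V, #{e ∈ F | R (σ e.1) (σ e.2)} = ∑ e ∈ F, f e := fun F => by
    simp only [hf, card_filter]
    exact sum_comm
  have f_const : ∀ e ∈ D, ∀ e' ∈ D, f e = f e' := by
    intro e he e' he'
    obtain ⟨τ, h1, h2⟩ := (MulAction.is_two_pretransitive_iff (G := Equiv.Perm V)).1
      (Equiv.Perm.isMultiplyPretransitive V 2) (mem_offDiag.1 he).2.2 (mem_offDiag.1 he').2.2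
    rw [Equiv.Perm.smul_def] at h1 h2
    refine card_equiv (Equiv.mulRight τ⁻¹) fun σ => ?_
    simp [← h1, ← h2]
  have card_image : ∀ σ : Equiv.Perm V,
      #{e ∈ D | R (σ e.1) (σ e.2)} = #{e ∈ D | R e.1 e.2} := fun σ =>
    card_equiv (Equiv.prodCongr σ σ) fun e => by simp [hD]
  by_contra! hlt
  have hsum : ∑ σ : Equiv.Perm V, #D * #{e ∈ E | R (σ e.1) (σ e.2)} <
      ∑ _σ : Equiv.Perm V, #{e ∈ D | R e.1 e.2} * #E :=
    sum_lt_sum_of_nonempty univ_nonempty fun σ _ => hlt σ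
  have hsub : ∀ e ∈ E, e ∈ D := fun e he => by simpa [hD] using hE e he
  have hsumD : ∑ _σ : Equiv.Perm V, #{e ∈ D | R e.1 e.2} = ∑ e ∈ D, f e := by
    rw [← double_count]
    exact sum_congr rfl fun σ _ => (card_image σ).symm
  rw [← mul_sum, double_count, ← sum_mul, hsumD] at hsum
  obtain rfl | ⟨e₀, he₀⟩ := E.eq_empty_or_nonempty
  · simp at hsum
  · rw [sum_congr rfl fun e he => f_const e (hsub e he) e₀ (hsub e₀ he₀),
      sum_congr rfl fun e he => f_const e he e₀ (hsub e₀ he₀)] at hsum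
    simp only [sum_const, smul_eq_mul] at hsum
    exact hsum.ne (by ring)

/-- Comparing `c` on ordered pairs: the pairs with `c i ≤ c j` and their reversals cover every pair,
and cover twice the pairs with `c i = c j`. -/
lemma two_mul_card_filter_le {V : Type*} [Fintype V] [DecidableEq V] (c : V → ℕ) :
    2 * #{e : V × V | c e.1 ≤ c e.2} = Fintype.card V ^ 2 + #{e : V × V | c e.1 = c e.2} := by
  have hswap : #{e : V × V | c e.2 ≤ c e.1} = #{e : V × V | c e.1 ≤ c e.2} :=
    card_equiv (Equiv.prodComm V V) fun e => by simp
  have h := card_union_add_card_inter {e : V × V | c e.1 ≤ c e.2} {e : V × V | c e.2 ≤ c e.1}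
  rw [← filter_or, ← filter_and, hswap] at h
  simp only [le_total, filter_true, ← le_antisymm_iff, card_univ, Fintype.card_prod] at h
  rw [two_mul, ← h, sq]

/-- Cutting `Fin n` into `k` intervals of length `m` and a remainder of length at most `m`, the
number of ordered pairs inside a common part is at least `k m² + (n - k m)²`. -/
lemma le_card_filter_div_eq {n m k : ℕ} (hm : 0 < m) (hkn : k * m ≤ n) (hnk : n ≤ (k + 1) * m) :
    k * m * m + (n - k * m) * (n - k * m) ≤
      #{e : Fin n × Fin n | (e.1 : ℕ) / m = (e.2 : ℕ) / m} := by
  have hcount : #{e : Fin n × Fin n | (e.1 : ℕ) / m = (e.2 : ℕ) / m} =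
      ∑ i ∈ range n, #{j ∈ range n | i / m = j / m} := by
    simp only [card_filter, ← univ_product_univ, sum_product, sum_range]
  rw [hcount, ← sum_range_add_sum_Ico _ hkn]
  refine add_le_add ?_ ?_
  · refine le_trans (by simp) (card_nsmul_le_sum (range (k * m)) _ m fun i hi => ?_)
    have hi' : i / m < k := (Nat.div_lt_iff_lt_mul hm).2 (mem_range.1 hi)
    have hle : (i / m + 1) * m ≤ k * m := Nat.mul_le_mul_right m hi'
    calc m = #(Ico (i / m * m) ((i / m + 1) * m)) := by simp [add_mul]
      _ ≤ _ := card_le_card fun j hj => by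
        rw [mem_Ico] at hj
        rw [mem_filter, mem_range]
        exact ⟨by omega, (Nat.div_eq_of_lt_le hj.1 hj.2).symm⟩
  · have hpart : ∀ j ∈ Ico (k * m) n, j / m = k := fun j hj => by
      rw [mem_Ico] at hj
      exact Nat.div_eq_of_lt_le hj.1 (by omega)
    refine le_trans (by simp) (card_nsmul_le_sum (Ico (k * m) n) _ (n - k * m) fun i hi => ?_)
    calc n - k * m = #(Ico (k * m) n) := by simp
      _ ≤ _ := card_le_card fun j hj => by
        rw [mem_filter, mem_range, hpart i hi, hpart j hj]
        exact ⟨(mem_Ico.1 hj).2, rfl⟩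

/-- If `c` is non-decreasing along every edge, each directed cycle lies in one fibre of `c`. -/
lemma HasDirCycle.exists_le_card_fiber {n ℓ : ℕ} {E : Finset (Fin n × Fin n)}
    (h : HasDirCycle E ℓ) (hℓ : 0 < ℓ) (c : Fin n → ℕ) (hc : ∀ e ∈ E, c e.1 ≤ c e.2) :
    ∃ t, ℓ ≤ #{x | c x = t} := by
  obtain ⟨v, hinj, hv⟩ := h
  have hstep : ∀ i (hi : i + 1 < ℓ), c (v ⟨i, by omega⟩) ≤ c (v ⟨i + 1, hi⟩) := fun i hi => by
    simpa [Nat.mod_eq_of_lt hi] using hc _ (hv ⟨i, by omega⟩)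
  have hmono : ∀ j (hj : j < ℓ), ∀ i (hij : i ≤ j), c (v ⟨i, by omega⟩) ≤ c (v ⟨j, hj⟩) := by
    intro j
    induction j with
    | zero => intro hj i hij; obtain rfl : i = 0 := by omega
              rfl
    | succ j ih =>
      intro hj i hij
      rcases hij.eq_or_lt with rfl | hlt
      · rfl
      · exact (ih (by omega) i (by omega)).trans (hstep j hj)
  have hlast : c (v ⟨ℓ - 1, by omega⟩) ≤ c (v ⟨0, hℓ⟩) := by
    simpa [Nat.sub_add_cancel hℓ] using hc _ (hv ⟨ℓ - 1, by omega⟩)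
  refine ⟨c (v ⟨0, hℓ⟩), ?_⟩
  calc ℓ = #(univ.image v) := by simp [card_image_of_injective _ hinj]
    _ ≤ _ := card_le_card fun x hx => by
      obtain ⟨i, -, rfl⟩ := mem_image.1 hx
      rw [mem_filter]
      exact ⟨mem_univ _, le_antisymm
        ((hmono (ℓ - 1) (by omega) i (by omega)).trans hlast) (hmono i i.2 0 (by omega))⟩

/-- The fibres of `i ↦ σ i / m` have at most `m` elements. -/
lemma card_filter_perm_div_eq_le {n m : ℕ} (hm : 0 < m) (σ : Equiv.Perm (Fin n)) (t : ℕ) :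
    #{x : Fin n | (σ x : ℕ) / m = t} ≤ m := by
  calc #{x : Fin n | (σ x : ℕ) / m = t} ≤ #(Ico (t * m) ((t + 1) * m)) := by
        refine card_le_card_of_injOn (fun x => (σ x : ℕ)) (fun x hx => ?_)
          fun x _ y _ hxy => σ.injective (Fin.ext hxy)
        simp only [coe_filter, mem_univ, true_and, Set.mem_ofPred_eq] at hx
        simp only [coe_Ico, Set.mem_Ico, ← hx]
        exact ⟨Nat.div_mul_le_self _ _, by rw [mul_comm]; exact Nat.lt_mul_div_succ _ hm⟩
    _ = m := by simp [add_mul]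

theorem resilience_lower_bound
    (γ : ℝ) (hγ0 : 0 < γ) (hγ1 : γ < 1 / 2)
    (α : ℝ) (hα0 : 0 < α) (hα1 : α < 1)
    (hγα : 2 * γ = 1 - (1 - w α) * (α + w α))
    (ε : ℝ) (hε : 0 < ε) (C : ℝ) (hC : 0 < C) :
    ∃ n₀ : ℕ, ∃ K : ℝ, ∀ n : ℕ, n₀ ≤ n →
      ∀ (p r : ℝ) (E : Finset (Fin n × Fin n)),
        (∀ e ∈ E, e.1 ≠ e.2) →
        Pseudorandom E p r →
        r ≤ C * Real.sqrt ((n : ℝ) * p) →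
        K ≤ p * n →
        ∃ E' ⊆ E, (1 / 2 + γ - ε) * (E.card : ℝ) ≤ (E'.card : ℝ) ∧
          ∀ ℓ : ℕ, (1 - α) * (n : ℝ) < (ℓ : ℝ) → ¬ HasDirCycle E' ℓ := by
  set k := ⌊(1 - α)⁻¹⌋₊ with hk
  have hβ : 0 < 1 - α := by linarith
  have hw : w α = 1 - (1 - α) * k := by
    rw [w, hk, natCast_floor_eq_intCast_floor (inv_nonneg.2 hβ.le)]
  have hkβ : (1 - α) * k ≤ 1 := by
    have := mul_le_mul_of_nonneg_left (Nat.floor_le (inv_nonneg.2 hβ.le)) hβ.le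
    rwa [mul_inv_cancel₀ hβ.ne'] at this
  have hkβ' : 1 < (1 - α) * (k + 1) := by
    have := mul_lt_mul_of_pos_left (Nat.lt_floor_add_one (1 - α)⁻¹) hβ
    rwa [mul_inv_cancel₀ hβ.ne'] at this
  have hgap : 0 < (1 - α) * (k + 1) - 1 := by linarith
  obtain ⟨n₁, hn₁⟩ := exists_nat_ge ((k + 1 : ℝ) / ((1 - α) * (k + 1) - 1))
  obtain ⟨n₂, hn₂⟩ := exists_nat_ge (2 / ε)
  obtain ⟨n₃, hn₃⟩ := exists_nat_ge (1 / (1 - α))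
  refine ⟨max (max n₁ n₂) n₃, 0, fun n hn p r E hE _ _ _ => ?_⟩
  replace hn₁ : (k + 1 : ℝ) ≤ n * ((1 - α) * (k + 1) - 1) :=
    (div_le_iff₀ hgap).1 (hn₁.trans (Nat.cast_le.2 (by omega)))
  replace hn₂ : 2 ≤ n * ε := (div_le_iff₀ hε).1 (hn₂.trans (Nat.cast_le.2 (by omega)))
  replace hn₃ : 1 ≤ n * (1 - α) := (div_le_iff₀ hβ).1 (hn₃.trans (Nat.cast_le.2 (by omega)))
  set m := ⌊(1 - α) * n⌋₊ with hm
  have hm_pos : 0 < m := Nat.floor_pos.2 (by linarith)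
  have hm_le : (m : ℝ) ≤ (1 - α) * n := Nat.floor_le (by positivity)
  have hm_lt : (1 - α) * n < m + 1 := Nat.lt_floor_add_one _
  have hn_pos : (0 : ℝ) < n := by
    by_contra! h
    nlinarith
  have hk0 : (0 : ℝ) ≤ k := k.cast_nonneg
  have hkm : (k * m : ℝ) ≤ (1 - w α) * n := by
    rw [hw]
    nlinarith
  have hw0 : 0 ≤ w α := by linarith
  have hkn : k * m ≤ n := by
    have : (k * m : ℝ) ≤ n := by nlinarith
    exact_mod_cast this
  have hnk : n ≤ (k + 1) * m := by
    have : (n : ℝ) ≤ (k + 1) * m := by nlinarith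
    exact_mod_cast this
  obtain ⟨σ, hσ⟩ := exists_perm_card_filter_ge
    (fun i j : Fin n => (i : ℕ) / m ≤ (j : ℕ) / m) E hE
  refine ⟨{e ∈ E | (σ e.1 : ℕ) / m ≤ (σ e.2 : ℕ) / m}, filter_subset _ _, ?_, fun ℓ hℓ hcyc => ?_⟩
  · have hsame := le_card_filter_div_eq hm_pos hkn hnk
    have htwo := two_mul_card_filter_le fun i : Fin n => (i : ℕ) / m
    have hdiag : #{e : Fin n × Fin n | (e.1 : ℕ) / m ≤ (e.2 : ℕ) / m} ≤
        #{e ∈ (univ : Finset (Fin n)).offDiag | (e.1 : ℕ) / m ≤ (e.2 : ℕ) / m} + n := by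
      rw [← univ_product_univ, ← diag_union_offDiag, filter_union, add_comm]
      refine (card_union_le _ _).trans (Nat.add_le_add_right ?_ _)
      exact (card_filter_le _ _).trans (by simp)
    have hoff : #(univ : Finset (Fin n)).offDiag ≤ n * n := by simp [offDiag_card]
    replace hσ := hσ.trans (Nat.mul_le_mul_right _ hoff)
    rw [Fintype.card_fin] at htwo
    generalize #{e : Fin n × Fin n | (e.1 : ℕ) / m ≤ (e.2 : ℕ) / m} = A at *
    generalize #{e : Fin n × Fin n | (e.1 : ℕ) / m = (e.2 : ℕ) / m} = S at *
    generalize #{e ∈ (univ : Finset (Fin n)).offDiag | (e.1 : ℕ) / m ≤ (e.2 : ℕ) / m} = N at *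
    generalize #{e ∈ E | (σ e.1 : ℕ) / m ≤ (σ e.2 : ℕ) / m} = M at *
    rify [hkn] at hsame htwo hdiag hσ
    have hrem : (w α * n) * (w α * n) ≤ (n - k * m) * (n - k * m : ℝ) :=
      mul_self_le_mul_self (by positivity) (by linarith)
    have hfull : (k : ℝ) * (((1 - α) * n - 1) * ((1 - α) * n - 1)) ≤ k * m * m := by
      rw [mul_assoc]
      exact mul_le_mul_of_nonneg_left
        (mul_self_le_mul_self (by linarith) (by linarith)) hk0
    have hrounding := mul_nonneg hw0 hn_pos.le
    have hS : 2 * γ * (n * n) - 2 * n ≤ (S : ℝ) :=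
      calc 2 * γ * (n * n) - 2 * n
          ≤ 2 * γ * (n * n) - 2 * n + 2 * (w α * n) + k := by linarith
        _ = k * (((1 - α) * n - 1) * ((1 - α) * n - 1)) + (w α * n) * (w α * n) := by
          rw [hγα, hw]
          ring
        _ ≤ S := by linarith
    have hN : (1 / 2 + γ - ε) * (n * n) ≤ (N : ℝ) := by
      linarith [mul_le_mul_of_nonneg_left hn₂ hn_pos.le]
    have hfinal : (n * n : ℝ) * ((1 / 2 + γ - ε) * #E) ≤ n * n * M := by
      calc (n * n : ℝ) * ((1 / 2 + γ - ε) * #E) = (1 / 2 + γ - ε) * (n * n) * #E := by ring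
        _ ≤ N * #E := mul_le_mul_of_nonneg_right hN (Nat.cast_nonneg _)
        _ ≤ _ := hσ
    exact le_of_mul_le_mul_left hfinal (by positivity)
  · have hℓ_pos : 0 < ℓ := by
      have : (0 : ℝ) < ℓ := lt_of_le_of_lt (by positivity) hℓ
      exact_mod_cast this
    obtain ⟨t, ht⟩ := hcyc.exists_le_card_fiber hℓ_pos (fun x => (σ x : ℕ) / m)
      fun e he => (mem_filter.1 he).2
    have hle : (ℓ : ℝ) ≤ m := Nat.cast_le.2 (ht.trans (card_filter_perm_div_eq_le hm_pos σ t))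
    linarith
end

section
/- Let H be a directed bipartite graph with parts V₁ and V₂ of size |V₁| = |V₂| = t (all edges of H go between V₁ and V₂, in either direction), and let k be a positive integer with k ≤ t. Suppose that for every two sets A ⊆ V₁ and B ⊆ V₂ of size |A| = |B| = k, there is at least one edge directed from A to B and at least one edge directed from B to A. Then H contains a directed path of length (at least) 2t − 4k + 3. -/
/-- The digraph with edge set `E` has a directed path of length `ℓ`: a sequence of
`ℓ+1` distinct vertices, each with an edge to the next. -/
def HasDirPath {n : ℕ} (E : Finset (Fin n × Fin n)) (ℓ : ℕ) : Prop :=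
  ∃ v : Fin (ℓ + 1) → Fin n, Function.Injective v ∧
    ∀ i : Fin ℓ, (v i.castSucc, v i.succ) ∈ E

/-- A duplicate-free list, each of whose entries receives an edge from the next entry,
gives a directed path. -/
lemma HasDirPath.of_isChain {n : ℕ} {E : Finset (Fin n × Fin n)} {x : Fin n} {l : List (Fin n)}
    (hc : (x :: l).IsChain fun a b => (b, a) ∈ E) (hn : (x :: l).Nodup) :
    HasDirPath E l.length := by
  refine ⟨fun i => (x :: l)[l.length - i.val]'(by simp), ?_, ?_⟩
  · intro i j hij
    have h := (hn.getElem_inj_iff).1 hij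
    ext
    omega
  · intro i
    have e : l.length - (i.val + 1) + 1 = l.length - i.val := by omega
    have h := (List.isChain_iff_getElem.1 hc) (l.length - (i.val + 1))
      (by rw [e, List.length_cons]; omega)
    simp only [e] at h
    simpa using h

/-- Along a path of a bipartite digraph the vertices alternate between the two parts. -/
lemma countP_of_isChain_bipartite {n : ℕ} {E : Finset (Fin n × Fin n)} (l : List (Fin n)) :
    ∀ (x : Fin n) (U W : Finset (Fin n)), Disjoint U W →
      (∀ e ∈ E, (e.1 ∈ U ∧ e.2 ∈ W) ∨ (e.1 ∈ W ∧ e.2 ∈ U)) →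
      ((x :: l).IsChain fun a b => (b, a) ∈ E) → x ∈ U →
      (x :: l).countP (· ∈ W) ≤ (x :: l).countP (· ∈ U) ∧
      (x :: l).countP (· ∈ U) ≤ (x :: l).countP (· ∈ W) + 1 ∧
      (x :: l).length = (x :: l).countP (· ∈ U) + (x :: l).countP (· ∈ W) := by
  induction l with
  | nil =>
    intro x U W hd _ _ hx
    have hxW : x ∉ W := Finset.disjoint_left.1 hd hx
    simp [hx, hxW]
  | cons y l ih =>
    intro x U W hd hb hc hx
    have hxW : x ∉ W := Finset.disjoint_left.1 hd hx
    rw [List.isChain_cons_cons] at hc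
    have hy : y ∈ W := by
      rcases hb _ hc.1 with h | h
      · exact absurd h.2 hxW
      · exact h.1
    have h := ih y W U hd.symm (fun e he => (hb e he).symm) hc.2 hy
    rw [List.countP_cons (a := x), List.countP_cons (a := x), List.length_cons (a := x)]
    simp only [hx, hxW, decide_true, decide_false, if_true]
    simp only [Bool.false_eq_true, if_false]
    omega

/-- If a depth-first search is about to finish the `k`-th vertex `x` of the part `U`, while fewer
than `k` vertices of the part `W` are finished, then the current path is long. -/
lemma length_of_finishing_vertex {n : ℕ} {E : Finset (Fin n × Fin n)} {U W T : Finset (Fin n)}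
    {t k : ℕ} (hd : Disjoint U W) (hW : W.card = t)
    (hb : ∀ e ∈ E, (e.1 ∈ U ∧ e.2 ∈ W) ∨ (e.1 ∈ W ∧ e.2 ∈ U))
    (hexp : ∀ A ⊆ U, ∀ B ⊆ W, A.card = k → B.card = k → ∃ e ∈ E, e.1 ∈ A ∧ e.2 ∈ B)
    {x : Fin n} {l : List (Fin n)} (hc : (x :: l).IsChain fun a b => (b, a) ∈ E) (hx : x ∈ U)
    (hTW : (T ∩ W).card < k) (hTU : k ≤ (insert x T ∩ U).card)
    (hno : ∀ a ∈ insert x T, ∀ b ∈ W, b ∉ T → b ∉ x :: l → (a, b) ∉ E) :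
    2 * (t : ℤ) - 4 * (k : ℤ) + 3 ≤ (l.length : ℤ) := by
  have halt := countP_of_isChain_bipartite l x U W hd hb hc hx
  have hS : ((W \ T) \ (x :: l).toFinset).card < k := by
    by_contra! hS
    obtain ⟨A, hA, hAk⟩ := Finset.exists_subset_card_eq hTU
    obtain ⟨B, hB, hBk⟩ := Finset.exists_subset_card_eq hS
    obtain ⟨e, he, h1, h2⟩ := hexp A (hA.trans Finset.inter_subset_right) B
      (hB.trans (Finset.sdiff_subset.trans Finset.sdiff_subset)) hAk hBk
    have h2' := hB h2
    rw [Finset.mem_sdiff, Finset.mem_sdiff, List.mem_toFinset] at h2'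
    exact hno e.1 (Finset.mem_inter.1 (hA h1)).1 e.2 h2'.1.1 h2'.1.2 h2'.2 he
  have hP : ((x :: l).filter (· ∈ W)).toFinset.card ≤ (x :: l).countP (· ∈ W) := by
    rw [List.countP_eq_length_filter]
    exact List.toFinset_card_le _
  have hcover : W ⊆ (T ∩ W) ∪ ((W \ T) \ (x :: l).toFinset) ∪
      ((x :: l).filter (· ∈ W)).toFinset := by
    intro w hw
    simp only [Finset.mem_union, Finset.mem_inter, Finset.mem_sdiff, List.mem_toFinset,
      List.mem_filter, decide_eq_true_eq]
    tauto
  have h1 := Finset.card_le_card hcover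
  have h2 := Finset.card_union_le ((T ∩ W) ∪ ((W \ T) \ (x :: l).toFinset))
    ((x :: l).filter (· ∈ W)).toFinset
  have h3 := Finset.card_union_le (T ∩ W) ((W \ T) \ (x :: l).toFinset)
  have h4 := halt.2.2
  rw [List.length_cons] at h4
  omega

/-- A duplicate-free list avoiding a finite set is no longer than its complement is large. -/
lemma length_le_card_compl {α : Type*} [Fintype α] [DecidableEq α] {P : List α} {T : Finset α}
    (hn : P.Nodup) (hPT : ∀ x ∈ P, x ∉ T) : P.length ≤ Tᶜ.card := by
  rw [← List.toFinset_card_of_nodup hn]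
  exact Finset.card_le_card fun x hx => Finset.mem_compl.2 (hPT x (List.mem_toFinset.1 hx))

/-- Depth-first search from a state with current path `P` (listed from its end) and set `T` of
finished vertices, with fewer than `k` finished vertices in each part. -/
lemma exists_long_path_of_search_state {n : ℕ} {E : Finset (Fin n × Fin n)}
    {V₁ V₂ : Finset (Fin n)} {t k : ℕ} (hd : Disjoint V₁ V₂) (h₁ : V₁.card = t)
    (h₂ : V₂.card = t) (hb : ∀ e ∈ E, (e.1 ∈ V₁ ∧ e.2 ∈ V₂) ∨ (e.1 ∈ V₂ ∧ e.2 ∈ V₁))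
    (hkt : k ≤ t)
    (hexp₁ : ∀ A ⊆ V₁, ∀ B ⊆ V₂, A.card = k → B.card = k → ∃ e ∈ E, e.1 ∈ A ∧ e.2 ∈ B)
    (hexp₂ : ∀ A ⊆ V₂, ∀ B ⊆ V₁, A.card = k → B.card = k → ∃ e ∈ E, e.1 ∈ A ∧ e.2 ∈ B)
    (P : List (Fin n)) (T : Finset (Fin n)) (hc : P.IsChain fun a b => (b, a) ∈ E)
    (hn : P.Nodup) (hPV : ∀ x ∈ P, x ∈ V₁ ∪ V₂) (hPT : ∀ x ∈ P, x ∉ T)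
    (hT₁ : (T ∩ V₁).card < k) (hT₂ : (T ∩ V₂).card < k)
    (hno : ∀ a ∈ T, ∀ b ∈ V₁ ∪ V₂, b ∉ T → b ∉ P → (a, b) ∉ E) :
    ∃ ℓ : ℕ, 2 * (t : ℤ) - 4 * (k : ℤ) + 3 ≤ (ℓ : ℤ) ∧ HasDirPath E ℓ := by
  match P with
  | [] =>
    obtain ⟨y, hy, hyT⟩ : ∃ y ∈ V₁, y ∉ T := by
      by_contra! h
      rw [Finset.inter_eq_right.2 h] at hT₁
      omega
    exact exists_long_path_of_search_state hd h₁ h₂ hb hkt hexp₁ hexp₂ [y] T (by simp) (by simp)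
      (by simp [hy]) (by simp [hyT]) hT₁ hT₂ fun a ha b hb hbT _ => hno a ha b hb hbT (by simp)
  | x :: l =>
    by_cases hy : ∃ y ∈ V₁ ∪ V₂, y ∉ T ∧ y ∉ x :: l ∧ (x, y) ∈ E
    · obtain ⟨y, hyV, hyT, hyP, hxy⟩ := hy
      exact exists_long_path_of_search_state hd h₁ h₂ hb hkt hexp₁ hexp₂ (y :: x :: l) T
        (List.isChain_cons_cons.2 ⟨hxy, hc⟩) (List.nodup_cons.2 ⟨hyP, hn⟩)
        (List.forall_mem_cons.2 ⟨hyV, hPV⟩) (List.forall_mem_cons.2 ⟨hyT, hPT⟩) hT₁ hT₂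
        fun a ha b hb hbT hbP => hno a ha b hb hbT fun h => hbP (List.mem_cons_of_mem _ h)
    · push Not at hy
      have hno' : ∀ a ∈ insert x T, ∀ b ∈ V₁ ∪ V₂, b ∉ T → b ∉ x :: l → (a, b) ∉ E := by
        intro a ha b hb hbT hbP
        rcases Finset.mem_insert.1 ha with rfl | ha
        · exact hy b hb hbT hbP
        · exact hno a ha b hb hbT hbP
      have hxT : x ∉ T := hPT x (by simp)
      by_cases h : (insert x T ∩ V₁).card < k ∧ (insert x T ∩ V₂).card < k
      · refine exists_long_path_of_search_state hd h₁ h₂ hb hkt hexp₁ hexp₂ l (insert x T)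
          hc.of_cons hn.of_cons (fun z hz => hPV z (List.mem_cons_of_mem _ hz)) ?_ h.1 h.2 ?_
        · intro z hz hzT
          rcases Finset.mem_insert.1 hzT with rfl | hzT
          · exact (List.nodup_cons.1 hn).1 hz
          · exact hPT z (List.mem_cons_of_mem _ hz) hzT
        · intro a ha b hb hbT hbP
          rw [Finset.mem_insert, not_or] at hbT
          exact hno' a ha b hb hbT.2 (by simp [hbT.1, hbP])
      · refine ⟨l.length, ?_, HasDirPath.of_isChain hc hn⟩
        rcases Finset.mem_union.1 (hPV x (by simp)) with hx | hx
        · have hx' : x ∉ V₂ := Finset.disjoint_left.1 hd hx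
          rw [Finset.insert_inter_of_notMem hx'] at h
          exact length_of_finishing_vertex hd h₂ hb hexp₁ hc hx hT₂ (by omega)
            fun a ha b hb => hno' a ha b (Finset.mem_union_right _ hb)
        · have hx' : x ∉ V₁ := Finset.disjoint_right.1 hd hx
          rw [Finset.insert_inter_of_notMem hx'] at h
          exact length_of_finishing_vertex hd.symm h₁ (fun e he => (hb e he).symm) hexp₂ hc hx
            hT₁ (by omega) fun a ha b hb => hno' a ha b (Finset.mem_union_left _ hb)
termination_by 2 * Tᶜ.card - P.length
decreasing_by
  · have : 0 < Tᶜ.card := Finset.card_pos.2 ⟨y, Finset.mem_compl.2 hyT⟩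
    simp only [List.length_cons, List.length_nil]
    omega
  · have := length_le_card_compl (List.nodup_cons.2 ⟨hyP, hn⟩)
      (List.forall_mem_cons.2 ⟨hyT, hPT⟩)
    simp only [List.length_cons] at this ⊢
    omega
  · have h1 := length_le_card_compl hn hPT
    have h2 : (insert x T)ᶜ.card < Tᶜ.card := by
      rw [Finset.compl_insert]
      exact Finset.card_erase_lt_of_mem (Finset.mem_compl.2 hxT)
    simp only [List.length_cons] at h1 ⊢
    omega

/-- A directed bipartite graph between parts of size `t` in which every pair of
`k`-sets spans an edge in each direction contains a directed path of
length `2t − 4k + 3`. -/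
theorem long_path_in_bipartite_expander
    (n : ℕ) (V₁ V₂ : Finset (Fin n)) (hdisj : Disjoint V₁ V₂)
    (t : ℕ) (ht₁ : V₁.card = t) (ht₂ : V₂.card = t)
    (E : Finset (Fin n × Fin n)) (hE : ∀ e ∈ E, e.1 ≠ e.2)
    (hbip : ∀ e ∈ E, (e.1 ∈ V₁ ∧ e.2 ∈ V₂) ∨ (e.1 ∈ V₂ ∧ e.2 ∈ V₁))
    (k : ℕ) (hk0 : 0 < k) (hkt : k ≤ t)
    (hexp : ∀ A ⊆ V₁, ∀ B ⊆ V₂, A.card = k → B.card = k →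
      (∃ e ∈ E, e.1 ∈ A ∧ e.2 ∈ B) ∧ (∃ e ∈ E, e.1 ∈ B ∧ e.2 ∈ A)) :
    ∃ ℓ : ℕ, 2 * (t : ℤ) - 4 * (k : ℤ) + 3 ≤ (ℓ : ℤ) ∧ HasDirPath E ℓ :=
  exists_long_path_of_search_state hdisj ht₁ ht₂ hbip hkt
    (fun A hA B hB hAk hBk => (hexp A hA B hB hAk hBk).1)
    (fun A hA B hB hAk hBk => (hexp B hB A hA hBk hAk).2)
    [] ∅ (by simp) (by simp) (by simp) (by simp) (by simpa) (by simpa) (by simp)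
end

section
/- Let n and ℓ be integers with 3 ≤ ℓ ≤ n, and let r = (n−1) mod (ℓ−2). Every (undirected, simple) graph G on n vertices satisfying e(G) ≥ ⌈(n−1)/(ℓ−2)⌉ · ((ℓ−1) choose 2) + ((r+1) choose 2) + 1 contains a cycle of length at least ℓ. -/
/-- The simple graph `G` has a cycle of length `ℓ`: a sequence of `ℓ` distinct
vertices, consecutive ones adjacent, cyclically. -/
def HasCycleLen {n : ℕ} (G : SimpleGraph (Fin n)) (ℓ : ℕ) : Prop :=
  ∃ v : Fin ℓ → Fin n, Function.Injective v ∧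
    ∀ i : Fin ℓ, G.Adj (v i) (v ⟨(i.val + 1) % ℓ, Nat.mod_lt _ i.pos⟩)

/-- The number of ordered pairs `(x, y)` with `x ∈ X`, `y ∈ Y` and `x` adjacent to `y`. -/
def adjPairs {V : Type*} (G : SimpleGraph V) [DecidableRel G.Adj] (X Y : Finset V) : ℕ :=
  ∑ x ∈ X, ∑ y ∈ Y, if G.Adj x y then 1 else 0

/-- `f 0, …, f k` is a path of `G` inside the vertex set `A`. -/
structure IsPathIn {V : Type*} (G : SimpleGraph V) (A : Finset V) (k : ℕ) (f : ℕ → V) : Prop where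
  mem : ∀ i ≤ k, f i ∈ A
  inj : ∀ i ≤ k, ∀ j ≤ k, f i = f j → i = j
  adj : ∀ i < k, G.Adj (f i) (f (i + 1))

section

variable {V : Type*} {G : SimpleGraph V}

theorem IsPathIn.cons {A : Finset V} {k : ℕ} {f : ℕ → V} (hf : IsPathIn G A k f) {y : V}
    (hy : y ∈ A) (hadj : G.Adj (f 0) y) (hne : ∀ i ≤ k, f i ≠ y) :
    IsPathIn G A (k + 1) (fun i => if i = 0 then y else f (i - 1)) := by
  refine ⟨fun i hi => ?_, fun i hi j hj h => ?_, fun i hi => ?_⟩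
  · split_ifs
    · exact hy
    · exact hf.mem _ (by omega)
  · split_ifs at h with h1 h2 h2
    · omega
    · exact absurd h.symm (hne _ (by omega))
    · exact absurd h (hne _ (by omega))
    · have := hf.inj _ (by omega) _ (by omega) h
      omega
  · rcases Nat.eq_zero_or_pos i with rfl | hi0
    · simpa using hadj.symm
    · obtain ⟨t, rfl⟩ : ∃ t, i = t + 1 := ⟨i - 1, by omega⟩
      simpa using hf.adj t (by omega)

/-- Reversing the first `j + 1` vertices of a path whose start is adjacent to `f (j + 1)`. -/
theorem IsPathIn.rotate {A : Finset V} {k : ℕ} {f : ℕ → V} (hf : IsPathIn G A k f) {j : ℕ}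
    (hj : j < k) (hadj : G.Adj (f 0) (f (j + 1))) :
    IsPathIn G A k (fun i => f (if i ≤ j then j - i else i)) := by
  refine ⟨fun i hi => hf.mem _ (by split_ifs <;> omega), fun i hi i' hi' h => ?_, fun i hi => ?_⟩
  · have := hf.inj _ (by split_ifs <;> omega) _ (by split_ifs <;> omega) h
    split_ifs at this <;> omega
  · rcases lt_trichotomy i j with h | rfl | h
    · rw [if_pos (by omega), if_pos (by omega)]
      have := hf.adj (j - (i + 1)) (by omega)
      rw [show j - (i + 1) + 1 = j - i by omega] at this
      exact this.symm
    · simpa using hadj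
    · rw [if_neg (by omega), if_neg (by omega)]
      exact hf.adj i hi

theorem IsPathIn.lt_card {A : Finset V} {k : ℕ} {f : ℕ → V} (hf : IsPathIn G A k f) :
    k < A.card := by
  classical
  have h : ((Finset.range (k + 1)).image f).card = k + 1 := by
    rw [Finset.card_image_of_injOn, Finset.card_range]
    intro i hi j hj h
    simp only [Finset.coe_range, Set.mem_Iio] at hi hj
    exact hf.inj i (by omega) j (by omega) h
  have := Finset.card_le_card (s := (Finset.range (k + 1)).image f) (t := A) (by
    intro x hx
    obtain ⟨i, hi, rfl⟩ := Finset.mem_image.1 hx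
    exact hf.mem i (by simp at hi; omega))
  omega

variable [DecidableRel G.Adj]

theorem adjPairs_comm (X Y : Finset V) : adjPairs G X Y = adjPairs G Y X := by
  unfold adjPairs
  rw [Finset.sum_comm]
  simp only [G.adj_comm]

theorem adjPairs_eq_sum_card (X Y : Finset V) :
    adjPairs G X Y = ∑ x ∈ X, (Y.filter (G.Adj x)).card := by
  simp only [adjPairs, Finset.sum_boole, Nat.cast_id]

theorem adjPairs_eq_add_of_subset [DecidableEq V] {A S : Finset V} (hS : S ⊆ A) :
    adjPairs G A A = adjPairs G (A \ S) (A \ S) + adjPairs G S A + adjPairs G S (A \ S) := by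
  have h1 : adjPairs G A A = adjPairs G (A \ S) A + adjPairs G S A :=
    (Finset.sum_sdiff hS).symm
  have h2 : adjPairs G A (A \ S) = adjPairs G (A \ S) (A \ S) + adjPairs G S (A \ S) :=
    (Finset.sum_sdiff hS).symm
  rw [h1, adjPairs_comm (A \ S) A, h2]
  omega

/-- In a nonempty vertex set there is a longest path whose start has, among all starts of longest
paths, the largest number of neighbours. -/
theorem exists_longest_path {A : Finset V} (hA : A.Nonempty) :
    ∃ k f, IsPathIn G A k f ∧ (∀ g, ¬ IsPathIn G A (k + 1) g) ∧
      ∀ g, IsPathIn G A k g → (A.filter (G.Adj (g 0))).card ≤ (A.filter (G.Adj (f 0))).card := by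
  classical
  obtain ⟨a, ha⟩ := hA
  let P : ℕ → Prop := fun k => ∃ f, IsPathIn G A k f
  have h0 : P 0 := ⟨fun _ => a, fun _ _ => ha, fun i hi j hj _ => by omega, fun i hi => by omega⟩
  have hk : P (Nat.findGreatest P A.card) := Nat.findGreatest_spec (Nat.zero_le _) h0
  set k := Nat.findGreatest P A.card with hkdef
  let Q : ℕ → Prop := fun d => ∃ f, IsPathIn G A k f ∧ (A.filter (G.Adj (f 0))).card = d
  obtain ⟨f₀, hf₀⟩ := hk
  have hd : Q (Nat.findGreatest Q A.card) :=
    Nat.findGreatest_spec (Finset.card_filter_le _ _) ⟨f₀, hf₀, rfl⟩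
  obtain ⟨f, hf, hfd⟩ := hd
  refine ⟨k, f, hf, fun g hg => ?_, fun g hg => ?_⟩
  · have : k + 1 ≤ k := Nat.le_findGreatest hg.lt_card.le ⟨g, hg⟩
    omega
  · rw [hfd]
    exact Nat.le_findGreatest (Finset.card_filter_le _ _) ⟨g, hg, rfl⟩

/-- If every path `f 0, …, f j` with `j ≥ m` has nonadjacent ends, then every vertex set `A` with at
least two elements has a nonempty proper subset `S` such that at most `m |S| / 2` edges inside `A`
meet `S`. -/
theorem exists_sparse_subset [DecidableEq V] {m : ℕ}
    (hcyc : ∀ A k f, IsPathIn G A k f → ∀ j ≤ k, m ≤ j → ¬ G.Adj (f 0) (f j))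
    {A : Finset V} (hA : 1 < A.card) :
    ∃ S ⊆ A, S.Nonempty ∧ S.card < A.card ∧
      adjPairs G S A + adjPairs G S (A \ S) ≤ m * S.card := by
  by_cases hiso : ∃ x ∈ A, ∀ y ∈ A, ¬ G.Adj x y
  · obtain ⟨x, hx, hxy⟩ := hiso
    refine ⟨{x}, by simpa using hx, by simp, by simpa using hA, ?_⟩
    have h1 : adjPairs G {x} A = 0 := by
      simpa [adjPairs] using hxy
    have h2 : adjPairs G {x} (A \ {x}) = 0 := by
      simp only [adjPairs, Finset.sum_singleton]
      exact Finset.sum_eq_zero fun y hy => if_neg (hxy y (Finset.mem_sdiff.1 hy).1)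
    omega
  push Not at hiso
  obtain ⟨k, f, hf, hlong, hmax⟩ := exists_longest_path (G := G)
    (Finset.card_pos.1 (by omega : 0 < A.card))
  have hnbr : ∀ g, IsPathIn G A k g → ∀ y ∈ A, G.Adj (g 0) y → ∃ i < m, i ≤ k ∧ g i = y := by
    intro g hg y hy hadj
    by_contra! hcon
    refine hlong _ (hg.cons hy hadj fun i hi h => ?_)
    by_cases him : i < m
    · exact hcon i him hi h
    · exact hcyc A k g hg i hi (by omega) (h ▸ hadj)
  let J := (Finset.range k).filter fun j => G.Adj (f 0) (f (j + 1))
  have hJ : ∀ j, j ∈ J ↔ j < k ∧ G.Adj (f 0) (f (j + 1)) := by simp [J]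
  have hJm : ∀ j ∈ J, j + 1 < m := by
    intro j hj
    rw [hJ] at hj
    by_contra h
    exact hcyc A k f hf (j + 1) (by omega) (by omega) hj.2
  let S := J.image f
  let Z := ((Finset.range (k + 1)).filter (· < m)).image f
  have hSA : S ⊆ A := by
    intro x hx
    obtain ⟨j, hj, rfl⟩ := Finset.mem_image.1 hx
    exact hf.mem j ((hJ j).1 hj).1.le
  have hSZ : S ⊆ Z := by
    intro x hx
    obtain ⟨j, hj, rfl⟩ := Finset.mem_image.1 hx
    have h1 := hJm j hj
    have h2 := ((hJ j).1 hj).1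
    exact Finset.mem_image_of_mem f (by simp; omega)
  have hZ : Z.card ≤ m := by
    refine Finset.card_image_le.trans ?_
    calc _ ≤ (Finset.range m).card := Finset.card_le_card (by intro i; simp)
      _ = m := Finset.card_range m
  have hScard : S.card = J.card := Finset.card_image_of_injOn fun i hi j hj h =>
    hf.inj i ((hJ i).1 hi).1.le j ((hJ j).1 hj).1.le h
  have hNJ : A.filter (G.Adj (f 0)) = J.image fun j => f (j + 1) := by
    ext y
    simp only [Finset.mem_filter, Finset.mem_image]
    constructor
    · rintro ⟨hy, hadj⟩
      obtain ⟨i, -, hik, rfl⟩ := hnbr f hf y hy hadj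
      rcases i with _ | j
      · exact absurd hadj (G.loopless.irrefl _)
      · exact ⟨j, (hJ j).2 ⟨by omega, hadj⟩, rfl⟩
    · rintro ⟨j, hj, rfl⟩
      rw [hJ] at hj
      exact ⟨hf.mem _ (by omega), hj.2⟩
  have hdeg : (A.filter (G.Adj (f 0))).card = S.card := by
    rw [hNJ, hScard]
    refine Finset.card_image_of_injOn fun i hi j hj h => ?_
    have h1 := ((hJ i).1 hi).1
    have h2 := ((hJ j).1 hj).1
    have := hf.inj (i + 1) (by omega) (j + 1) (by omega) h
    omega
  have hSdeg : ∀ x ∈ S, (A.filter (G.Adj x)).card ≤ S.card ∧ A.filter (G.Adj x) ⊆ Z := by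
    intro x hx
    obtain ⟨j, hj, rfl⟩ := Finset.mem_image.1 hx
    have hjm := hJm j hj
    rw [hJ] at hj
    have hg := hf.rotate hj.1 hj.2
    refine ⟨by simpa [hdeg] using hmax _ hg, fun y hy => ?_⟩
    obtain ⟨hyA, hadj⟩ := Finset.mem_filter.1 hy
    obtain ⟨i, him, hik, rfl⟩ := hnbr _ hg y hyA (by simpa using hadj)
    refine Finset.mem_image_of_mem f ?_
    simp only [Finset.mem_filter, Finset.mem_range]
    split_ifs <;> omega
  refine ⟨S, hSA, ?_, ?_, ?_⟩
  · rw [← Finset.card_pos, ← hdeg, Finset.card_pos]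
    obtain ⟨y, hy, hadj⟩ := hiso (f 0) (hf.mem 0 (Nat.zero_le _))
    exact ⟨y, Finset.mem_filter.2 ⟨hy, hadj⟩⟩
  · calc S.card = J.card := hScard
      _ ≤ (Finset.range k).card := Finset.card_filter_le _ _
      _ = k := Finset.card_range k
      _ < A.card := hf.lt_card
  · have h1 : adjPairs G S A ≤ S.card * S.card := by
      rw [adjPairs_eq_sum_card]
      exact Finset.sum_le_card_nsmul _ _ _ fun x hx => (hSdeg x hx).1
    have h2 : adjPairs G S (A \ S) ≤ S.card * (m - S.card) := by
      rw [adjPairs_eq_sum_card]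
      refine Finset.sum_le_card_nsmul _ _ _ fun x hx => ?_
      calc _ ≤ (Z \ S).card := Finset.card_le_card fun y hy => by
            simp only [Finset.mem_filter, Finset.mem_sdiff] at hy ⊢
            exact ⟨(hSdeg x hx).2 (Finset.mem_filter.2 ⟨hy.1.1, hy.2⟩), hy.1.2⟩
        _ = Z.card - S.card := Finset.card_sdiff_of_subset hSZ
        _ ≤ m - S.card := by omega
    have h3 : S.card ≤ m := (Finset.card_le_card hSZ).trans hZ
    calc _ ≤ S.card * S.card + S.card * (m - S.card) := add_le_add h1 h2
      _ = S.card * (S.card + (m - S.card)) := by ring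
      _ = m * S.card := by rw [Nat.add_sub_cancel' h3, mul_comm]

/-- The Erdős–Gallai bound: a graph in which the ends of every path `f 0, …, f j` with `j ≥ m` are
nonadjacent (for `m ≥ 2`: a graph without cycles of length more than `m`) has at most
`m (|A| - 1) / 2` edges inside every nonempty vertex set `A`. -/
theorem adjPairs_add_le {m : ℕ}
    (hcyc : ∀ A k f, IsPathIn G A k f → ∀ j ≤ k, m ≤ j → ¬ G.Adj (f 0) (f j))
    (A : Finset V) (hA : A.Nonempty) : adjPairs G A A + m ≤ m * A.card := by
  classical
  induction A using Finset.strongInduction with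
  | H A ih =>
    rcases (Nat.succ_le_of_lt (Finset.card_pos.2 hA)).eq_or_lt with h1 | h1
    · obtain ⟨x, rfl⟩ := Finset.card_eq_one.1 h1.symm
      simp [adjPairs]
    · obtain ⟨S, hSA, hS, hlt, hle⟩ := exists_sparse_subset hcyc h1
      have hcard := Finset.card_sdiff_add_card_eq_card hSA
      have := ih (A \ S) (Finset.sdiff_ssubset hSA hS) (Finset.card_pos.1 (by omega))
      rw [adjPairs_eq_add_of_subset hSA, ← hcard, mul_add]
      omega

end

theorem IsPathIn.hasCycleLen {n : ℕ} {G : SimpleGraph (Fin n)} {A : Finset (Fin n)} {k : ℕ}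
    {f : ℕ → Fin n} (hf : IsPathIn G A k f) {j : ℕ} (hj : j ≤ k) (hadj : G.Adj (f 0) (f j)) :
    HasCycleLen G (j + 1) := by
  refine ⟨fun i => f i, fun a b h => ?_, fun i => ?_⟩
  · exact Fin.ext (hf.inj a (by omega) b (by omega) h)
  · rcases (Nat.lt_succ_iff.1 i.isLt).eq_or_lt with h | h
    · simpa [h] using hadj.symm
    · simpa [Nat.mod_eq_of_lt (show i.val + 1 < j + 1 by omega)] using hf.adj i (by omega)

/-- Woodall's theorem: every graph on `n` vertices with at least
`⌈(n−1)/(ℓ−2)⌉·C(ℓ−1,2) + C(r+1,2) + 1` edges, where `r = (n−1) mod (ℓ−2)`,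
has a cycle of length at least `ℓ`. -/
theorem woodall (n ℓ : ℕ) (hℓ : 3 ≤ ℓ) (hℓn : ℓ ≤ n)
    (G : SimpleGraph (Fin n)) [DecidableRel G.Adj]
    (hedges : ((n - 1) + (ℓ - 2) - 1) / (ℓ - 2) * Nat.choose (ℓ - 1) 2 +
        Nat.choose ((n - 1) % (ℓ - 2) + 1) 2 + 1 ≤ G.edgeFinset.card) :
    ∃ m : ℕ, ℓ ≤ m ∧ HasCycleLen G m := by
  by_contra! hcon
  obtain ⟨p, rfl⟩ : ∃ p, ℓ = p + 3 := ⟨ℓ - 3, by omega⟩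
  obtain ⟨N, rfl⟩ : ∃ N, n = N + 1 := ⟨n - 1, by omega⟩
  have hEG := adjPairs_add_le (G := G) (m := p + 2)
    (fun A k f hf j hj hmj hadj => hcon (j + 1) (by omega) (hf.hasCycleLen hj hadj))
    Finset.univ Finset.univ_nonempty
  have hsum : adjPairs G Finset.univ Finset.univ = 2 * G.edgeFinset.card := by
    rw [adjPairs_eq_sum_card, ← G.sum_degrees_eq_twice_card_edges]
    refine Finset.sum_congr rfl fun x _ => ?_
    rw [← G.card_neighborFinset_eq_degree, G.neighborFinset_eq_filter]
  rw [hsum, Finset.card_univ, Fintype.card_fin] at hEG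
  simp only [show p + 3 - 2 = p + 1 by omega, show p + 3 - 1 = p + 2 by omega,
    Nat.add_sub_cancel] at hedges
  have hchoose : 2 * Nat.choose (p + 2) 2 = (p + 2) * (p + 1) := by
    rw [Nat.choose_two_right]
    exact Nat.mul_div_cancel' (Nat.even_mul_pred_self (p + 2)).two_dvd
  have hceil : N ≤ (N + (p + 1) - 1) / (p + 1) * (p + 1) := by
    have h1 := Nat.div_add_mod (N + (p + 1) - 1) (p + 1)
    have h2 := Nat.mod_lt (N + (p + 1) - 1) (show 0 < p + 1 by omega)
    rw [mul_comm] at h1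
    omega
  generalize (N + (p + 1) - 1) / (p + 1) = q at hedges hceil
  have h3 : (p + 2) * N ≤ (p + 2) * (q * (p + 1)) := Nat.mul_le_mul_left _ hceil
  have h4 : 2 * (q * Nat.choose (p + 2) 2) = (p + 2) * (q * (p + 1)) := by
    rw [mul_left_comm, hchoose]
    ring
  rw [mul_add, mul_one] at hEG
  omega
end

section
/- Let 0 < α < 1. For every β > 0 there is an integer n₀ such that every (undirected, simple) graph G on n > n₀ vertices satisfying e(G) ≥ (n choose 2) · (1 − (1−w(α))(α+w(α)) + β) contains a cycle of length at least (1−α)·n. -/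
/-- `l` lists the vertices of a path of `G` from `x` to `y`. -/
def IsPathList {V : Type*} (G : SimpleGraph V) (x y : V) (l : List V) : Prop :=
  l.Nodup ∧ l.IsChain G.Adj ∧ l.head? = some x ∧ l.getLast? = some y

/-- `G` has a cycle through more than `c` vertices (a single edge counts as a closed walk of
length two). -/
def HasLongCycle {V : Type*} (G : SimpleGraph V) (c : ℕ) : Prop :=
  ∃ x y l, IsPathList G x y l ∧ G.Adj y x ∧ c < l.length

section Cycles

variable {V : Type*} {G : SimpleGraph V} {c : ℕ} {x y z : V} {l l₁ l₂ : List V}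

theorem IsPathList.reverse (h : IsPathList G x y l) : IsPathList G y x l.reverse := by
  obtain ⟨h1, h2, h3, h4⟩ := h
  refine ⟨by simpa using h1, ?_, by simpa using h4, by simpa using h3⟩
  rw [List.isChain_reverse]
  exact h2.imp fun _ _ h => h.symm

theorem IsPathList.ne_nil (h : IsPathList G x y l) : l ≠ [] := by
  rintro rfl
  simp [IsPathList] at h

theorem IsPathList.left_mem (h : IsPathList G x y l) : x ∈ l :=
  List.mem_of_mem_head? h.2.2.1

theorem IsPathList.right_mem (h : IsPathList G x y l) : y ∈ l :=
  List.mem_of_mem_getLast? h.2.2.2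

theorem isPathList_singleton (x : V) : IsPathList G x x [x] := by
  simp [IsPathList]

theorem IsPathList.append {u v : V} (h₁ : IsPathList G x u l₁) (h₂ : IsPathList G v y l₂)
    (huv : G.Adj u v) (hd : l₁.Disjoint l₂) : IsPathList G x y (l₁ ++ l₂) := by
  obtain ⟨a1, a2, a3, a4⟩ := h₁
  obtain ⟨b1, b2, b3, b4⟩ := h₂
  refine ⟨List.nodup_append'.2 ⟨a1, b1, hd⟩, List.isChain_append.2 ⟨a2, b2, ?_⟩, ?_, ?_⟩
  · simp [a4, b3, huv]
  · simp [a3]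
  · simp [b4]

theorem IsPathList.cons (h : IsPathList G x y l) (hz : G.Adj z x) (hzl : z ∉ l) :
    IsPathList G z y (z :: l) :=
  (isPathList_singleton z).append h hz (by simpa using hzl)

/-- A closed walk may be started at any of its vertices. -/
theorem IsPathList.rotate (h : IsPathList G x y (l₁ ++ z :: l₂)) (hyx : G.Adj y x) :
    ∃ w, IsPathList G z w (z :: (l₂ ++ l₁)) ∧ G.Adj w z := by
  obtain ⟨h1, h2, h3, h4⟩ := h
  rcases l₁.eq_nil_or_concat with rfl | ⟨l₁', w, rfl⟩
  · simp only [List.nil_append, List.head?_cons, Option.some.injEq] at h3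
    subst h3
    exact ⟨y, ⟨by simpa using h1, by simpa using h2, by simp, by simpa using h4⟩, hyx⟩
  · rw [List.concat_eq_append] at h1 h2 h3 h4 ⊢
    obtain ⟨c1, c2, c3⟩ := List.isChain_append.1 h2
    refine ⟨w, ⟨?_, ?_, by simp, ?_⟩, c3 w (by simp) z (by simp)⟩
    · exact (List.perm_append_comm (l₂ := z :: l₂)).nodup_iff.1 h1
    · rw [← List.cons_append]
      refine List.isChain_append.2 ⟨c2, c1, fun a ha b hb => ?_⟩
      have h3' : (l₁' ++ [w]).head? = some x := by
        cases l₁' <;> simpa using h3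
      rw [h3'] at hb
      have h4' : (z :: l₂).getLast? = some y := by
        simpa [List.getLast?_append] using h4
      rw [h4'] at ha
      simp only [Option.mem_def, Option.some.injEq] at ha hb
      subst ha hb
      exact hyx
    · rw [← List.cons_append, ← List.append_assoc, List.getLast?_concat]

theorem IsPathList.take (h : IsPathList G x y l) {i : ℕ} (hi : i < l.length) :
    IsPathList G x l[i] (l.take (i + 1)) := by
  obtain ⟨h1, h2, h3, h4⟩ := h
  refine ⟨h1.sublist (List.take_sublist _ _), h2.take _, ?_, ?_⟩
  · rw [List.head?_take, if_neg (by omega), h3]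
  · simp [List.getLast?_take, hi]

theorem IsPathList.drop (h : IsPathList G x y l) {i : ℕ} (hi : i < l.length) :
    IsPathList G l[i] y (l.drop i) := by
  obtain ⟨h1, h2, h3, h4⟩ := h
  refine ⟨h1.sublist (List.drop_sublist _ _), h2.drop _, ?_, ?_⟩
  · simp [hi]
  · rw [List.getLast?_drop, if_neg (by omega), h4]

/-- If adding the edge `xy` to `G` creates a long cycle, then `G` has a long path from `x`
to `y`. -/
theorem exists_path_of_hasLongCycle_sup_edge (hc : 2 ≤ c) (hG : ¬ HasLongCycle G c)
    (h : HasLongCycle (G ⊔ SimpleGraph.edge x y) c) :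
    ∃ l, IsPathList G x y l ∧ c < l.length := by
  have key : ∀ a b l, IsPathList (G ⊔ SimpleGraph.edge x y) a b l → c < l.length →
      ((a = x ∧ b = y) ∨ (a = y ∧ b = x)) → ∃ l, IsPathList G x y l ∧ c < l.length := by
    intro a b l hl hcl hab
    have hl' : IsPathList G a b l := by
      obtain ⟨h1, h2, h3, h4⟩ := hl
      refine ⟨h1, ?_, h3, h4⟩
      rw [List.isChain_iff_getElem] at h2 ⊢
      intro i hi
      have ha : l[0] = a := by
        rw [List.head?_eq_getElem?, List.getElem?_eq_getElem (by omega)] at h3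
        simpa using h3
      have hb : l[l.length - 1] = b := by
        rw [List.getLast?_eq_getElem?, List.getElem?_eq_getElem (by omega)] at h4
        simpa using h4
      rcases SimpleGraph.sup_adj .. |>.1 (h2 i hi) with h | h
      · exact h
      · exfalso
        rw [SimpleGraph.edge_adj] at h
        have e1 : ∀ j (hj : j < l.length), l[j] = a → j = 0 := fun j hj e =>
          (h1.getElem_inj_iff (hi := hj) (hj := by omega)).1 (e.trans ha.symm)
        have e2 : ∀ j (hj : j < l.length), l[j] = b → j = l.length - 1 := fun j hj e =>
          (h1.getElem_inj_iff (hi := hj) (hj := by omega)).1 (e.trans hb.symm)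
        have f1 := e1 i (by omega)
        have f2 := e2 i (by omega)
        have f3 := e1 (i + 1) (by omega)
        have f4 := e2 (i + 1) (by omega)
        rcases hab with ⟨rfl, rfl⟩ | ⟨rfl, rfl⟩ <;> rcases h.1 with ⟨q1, q2⟩ | ⟨q1, q2⟩ <;>
          simp only [q1, q2, true_implies] at f1 f2 f3 f4 <;> omega
    rcases hab with ⟨rfl, rfl⟩ | ⟨rfl, rfl⟩
    · exact ⟨l, hl', hcl⟩
    · exact ⟨_, hl'.reverse, by simpa using hcl⟩
  obtain ⟨a, b, l, hl, hba, hcl⟩ := h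
  by_cases hch : l.IsChain G.Adj
  · rcases SimpleGraph.sup_adj .. |>.1 hba with h | h
    · exact (hG ⟨a, b, l, ⟨hl.1, hch, hl.2.2⟩, h, hcl⟩).elim
    · rw [SimpleGraph.edge_adj] at h
      exact key a b l hl hcl (by tauto)
  · obtain ⟨i, hi, hadj⟩ := List.exists_not_getElem_of_not_isChain hch
    have hsplit : l = l.take (i + 1) ++ l[i + 1] :: l.drop (i + 2) := by
      rw [← List.drop_eq_getElem_cons, List.take_append_drop]
    have hedge := (SimpleGraph.sup_adj .. |>.1
      (List.isChain_iff_getElem.1 hl.2.1 i hi)).resolve_left hadj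
    rw [SimpleGraph.edge_adj] at hedge
    rw [hsplit] at hl
    obtain ⟨w, hw, -⟩ := hl.rotate hba
    have hwi : w = l[i] := by
      have := hw.2.2.2
      rw [← List.cons_append, List.getLast?_append] at this
      simp [List.getLast?_take, show i < l.length by omega] at this
      exact this.symm
    refine key _ _ _ hw ?_ (by rw [hwi]; tauto)
    have := congrArg List.length hsplit
    simp only [List.length_append, List.length_cons] at this ⊢
    omega

end Cycles

section LongCycles

variable {V : Type*} {G : SimpleGraph V} {c : ℕ} {x y : V} {l : List V}

open Classical in
/-- A path whose ends have two common neighbours on it and large total degree into it can be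
closed up to a long cycle. -/
theorem hasLongCycle_of_degree_sum (h : IsPathList G x y l) (hc : c < l.length) {u₁ u₂ : V}
    (hu : u₁ ≠ u₂) (hu₁ : u₁ ∈ l) (hu₂ : u₂ ∈ l) (hx₁ : G.Adj x u₁) (hx₂ : G.Adj x u₂)
    (hy₁ : G.Adj y u₁) (hy₂ : G.Adj y u₂)
    (hdeg : c < (l.toFinset.filter (G.Adj x)).card + (l.toFinset.filter (G.Adj y)).card) :
    HasLongCycle G c := by
  set m := l.length with hm
  let p : ℕ → V := fun k => l.getD k x
  have hp : ∀ k (hk : k < m), l[k] = p k := fun k hk => (List.getD_eq_getElem l x hk).symm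
  have hp0 : p 0 = x := by
    have := h.2.2.1
    rw [List.head?_eq_getElem?, List.getElem?_eq_getElem (by omega), hp 0 (by omega)] at this
    simpa using this
  have hpm : p (m - 1) = y := by
    have := h.2.2.2
    rw [List.getLast?_eq_getElem?, List.getElem?_eq_getElem (by omega), hp _ (by omega)] at this
    simpa using this
  let I := (Finset.range m).filter (fun k => G.Adj y (p k))
  let J := (Finset.range m).filter (fun k => G.Adj x (p k))
  have card_le : ∀ z : V, (l.toFinset.filter (G.Adj z)).card ≤
      ((Finset.range m).filter (fun k => G.Adj z (p k))).card := by
    intro z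
    refine (Finset.card_le_card ?_).trans (Finset.card_image_le (f := p))
    intro v hv
    simp only [Finset.mem_filter, List.mem_toFinset] at hv
    obtain ⟨k, hk, rfl⟩ := List.getElem_of_mem hv.1
    rw [hp k hk] at hv ⊢
    exact Finset.mem_image_of_mem _ (by simpa [hv.2] using hk)
  have hIJ : c < I.card + J.card := by
    have hJ : _ ≤ J.card := card_le x
    have hI : _ ≤ I.card := card_le y
    omega
  obtain ⟨k₁, hk₁, e₁⟩ := List.getElem_of_mem hu₁
  obtain ⟨k₂, hk₂, e₂⟩ := List.getElem_of_mem hu₂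
  rw [← hm] at hk₁ hk₂
  rw [hp _ hk₁] at e₁
  rw [hp _ hk₂] at e₂
  have hk : k₁ ≠ k₂ := fun e => hu (by rw [← e₁, ← e₂, e])
  let T := (I ×ˢ J).filter (fun q => q.1 < q.2)
  have hT : T.Nonempty := by
    rcases lt_or_gt_of_ne hk with hlt | hlt
    · exact ⟨(k₁, k₂), by simp [T, I, J, e₁, e₂, hx₂, hy₁, hk₁, hk₂, hlt]⟩
    · exact ⟨(k₂, k₁), by simp [T, I, J, e₁, e₂, hx₁, hy₂, hk₁, hk₂, hlt]⟩
  obtain ⟨⟨i, j⟩, hij, hmin⟩ := T.exists_min_image (fun q => q.2 - q.1) hT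
  have hmin' : ∀ a ∈ I, ∀ b ∈ J, a < b → j - i ≤ b - a := fun a ha b hb hab =>
    hmin (a, b) (by simp only [T, Finset.mem_filter, Finset.mem_product]; exact ⟨⟨ha, hb⟩, hab⟩)
  simp only [T, Finset.mem_filter, Finset.mem_product] at hij
  obtain ⟨⟨hiI, hjJ⟩, hlt⟩ := hij
  have hi := (Finset.mem_filter.1 hiI).2
  have hj := (Finset.mem_filter.1 hjJ).2
  have hjm : j < m := Finset.mem_range.1 (Finset.mem_filter.1 hjJ).1
  have him : i < m := by omega
  have hlen : c < (i + 1) + (m - j) := by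
    by_contra hle
    have hsub : I.image (· + 1) ∪ J ⊆ Finset.Icc 1 (i + 1) ∪ Finset.Ico j m := by
      intro k hk
      simp only [Finset.mem_union, Finset.mem_image, Finset.mem_Icc, Finset.mem_Ico] at hk ⊢
      rcases hk with ⟨k, hk, rfl⟩ | hk
      · have hkm : k < m := Finset.mem_range.1 (Finset.mem_filter.1 hk).1
        have hk1 : k ≠ m - 1 := by
          rintro rfl
          have := (Finset.mem_filter.1 hk).2
          rw [hpm] at this
          exact G.irrefl this
        by_contra hcon
        have := hmin' k hk j hjJ (by omega)
        omega
      · have hkm : k < m := Finset.mem_range.1 (Finset.mem_filter.1 hk).1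
        have hk1 : k ≠ 0 := by
          rintro rfl
          have := (Finset.mem_filter.1 hk).2
          rw [hp0] at this
          exact G.irrefl this
        by_contra hcon
        have := hmin' i hiI k hk (by omega)
        omega
    have hdisj : Disjoint (I.image (· + 1)) J := by
      rw [Finset.disjoint_left]
      intro k hk hkJ
      obtain ⟨k', hk', rfl⟩ := Finset.mem_image.1 hk
      have := hmin' k' hk' _ hkJ (by omega)
      omega
    have h1 := (Finset.card_le_card hsub).trans (Finset.card_union_le _ _)
    rw [Finset.card_union_of_disjoint hdisj,
      Finset.card_image_of_injective _ (add_left_injective 1)] at h1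
    simp only [Nat.card_Icc, Nat.card_Ico] at h1
    omega
  have hpath := (h.take him).append (h.drop hjm).reverse (by rw [hp i him]; exact hi.symm)
    (by simpa [List.disjoint_right] using
      (List.disjoint_right.1 (List.disjoint_take_drop h.1 (by omega : i + 1 ≤ j))))
  refine ⟨_, _, _, hpath, by rw [hp j hjm]; exact hj.symm, ?_⟩
  simp only [List.length_append, List.length_take, List.length_reverse, List.length_drop]
  omega

/-- Contract the set `R` to its vertex `r`. -/
def contract (G : SimpleGraph V) (R : Finset V) (r : V) : SimpleGraph V :=
  SimpleGraph.fromRel fun a b =>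
    b ∉ R ∧ ((a ∉ R ∧ G.Adj a b) ∨ (a = r ∧ ∃ s ∈ R, G.Adj s b))

/-- Any two vertices of `R` are joined by a path of `G` inside `R`. -/
def ConnectedIn (G : SimpleGraph V) (R : Finset V) : Prop :=
  ∀ a ∈ R, ∀ b ∈ R, ∃ l, IsPathList G a b l ∧ ∀ v ∈ l, v ∈ R

variable {R : Finset V} {r : V}

theorem contract_adj_of_notMem {a b : V} (ha : a ∉ R) (hb : b ∉ R) (hr : r ∈ R) :
    (contract G R r).Adj a b ↔ G.Adj a b := by
  have h1 : a ≠ r := fun e => ha (e ▸ hr)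
  have h2 : b ≠ r := fun e => hb (e ▸ hr)
  simp only [contract, SimpleGraph.fromRel_adj, ha, hb, h1, h2, not_false_eq_true, true_and,
    false_and, or_false, G.adj_comm b a, or_self, and_iff_right_iff_imp]
  exact fun h => h.ne

theorem contract_adj_left {b : V} (hr : r ∈ R) :
    (contract G R r).Adj r b ↔ b ∉ R ∧ ∃ s ∈ R, G.Adj s b := by
  simp only [contract, SimpleGraph.fromRel_adj, hr, not_true_eq_false, false_and, true_and,
    false_or, or_false]
  constructor
  · rintro ⟨-, h⟩
    exact h
  · rintro ⟨h, h'⟩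
    exact ⟨fun e => h (e ▸ hr), h, h'⟩

theorem eq_of_contract_adj {a b : V} (h : (contract G R r).Adj a b) (ha : a ∈ R) :
    a = r := by
  simp only [contract, SimpleGraph.fromRel_adj, ha, not_true_eq_false, false_and,
    false_or, or_false] at h
  exact h.2.2.1

/-- Long cycles lift along the contraction of a connected set. -/
theorem hasLongCycle_of_contract (hR : ConnectedIn G R) (hr : r ∈ R)
    (h : HasLongCycle (contract G R r) c) (hc : 1 ≤ c) : HasLongCycle G c := by
  obtain ⟨x, y, l, hl, hyx, hcl⟩ := h
  have hmem : ∀ x y l, IsPathList (contract G R r) x y l → (contract G R r).Adj y x →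
      ∀ v ∈ l, v ∈ R → v = r := by
    intro x y l hl hyx v hv hvR
    obtain ⟨l₁, l₂, rfl⟩ := List.append_of_mem hv
    obtain ⟨w, hw, hwv⟩ := hl.rotate hyx
    exact eq_of_contract_adj hwv.symm hvR
  have hlift : ∀ x y l, IsPathList (contract G R r) x y l → (∀ v ∈ l, v ∉ R) →
      IsPathList G x y l := by
    rintro x y l ⟨h1, h2, h3⟩ hlR
    refine ⟨h1, ?_, h3⟩
    rw [List.isChain_iff_getElem] at h2 ⊢
    intro i hi
    exact (contract_adj_of_notMem (hlR _ (List.getElem_mem _)) (hlR _ (List.getElem_mem _)) hr).1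
      (h2 i hi)
  by_cases hrl : r ∈ l
  · obtain ⟨l₁, l₂, rfl⟩ := List.append_of_mem hrl
    obtain ⟨w, hw, hwr⟩ := hl.rotate hyx
    have hR' : ∀ v ∈ l₂ ++ l₁, v ∉ R := by
      intro v hv hvR
      have := hmem _ _ _ hw hwr v (List.mem_cons_of_mem _ hv) hvR
      subst this
      exact (List.nodup_cons.1 hw.1).1 hv
    have hlen : c ≤ (l₂ ++ l₁).length := by
      simp only [List.length_append, List.length_cons] at hcl ⊢
      omega
    generalize l₂ ++ l₁ = t at *
    obtain ⟨a, t, rfl⟩ : ∃ a s, t = a :: s := by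
      cases t with
      | nil => simp at hlen; omega
      | cons a s => exact ⟨a, s, rfl⟩
    have hpath : IsPathList (contract G R r) a w (a :: t) :=
      ⟨(List.nodup_cons.1 hw.1).2, hw.2.1.of_cons, rfl, by simpa using hw.2.2.2⟩
    have hra : (contract G R r).Adj r a := (List.isChain_cons_cons.1 hw.2.1).1
    obtain ⟨-, s, hs, hsa⟩ := (contract_adj_left hr).1 hra
    obtain ⟨-, s', hs', hsw⟩ := (contract_adj_left hr).1 hwr.symm
    obtain ⟨q, hq, hqR⟩ := hR s' hs' s hs
    refine ⟨a, s, _, (hlift _ _ _ hpath hR').append hq hsw.symm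
      fun v hv hvq => hR' v hv (hqR v hvq), hsa, ?_⟩
    have := List.length_pos_of_ne_nil hq.ne_nil
    rw [List.length_append]
    omega
  · have hR' : ∀ v ∈ l, v ∉ R := fun v hv hvR => hrl (hmem _ _ _ hl hyx v hv hvR ▸ hv)
    refine ⟨x, y, l, hlift _ _ _ hl hR', ?_, hcl⟩
    exact (contract_adj_of_notMem (hR' _ hl.right_mem) (hR' _ hl.left_mem) hr).1 hyx

theorem ConnectedIn.insert [DecidableEq V] (hR : ConnectedIn G R) {s w : V} (hs : s ∈ R)
    (hsw : G.Adj s w) : ConnectedIn G (insert w R) := by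
  by_cases hw : w ∈ R
  · rwa [Finset.insert_eq_of_mem hw]
  have key : ∀ b ∈ R, ∃ l, IsPathList G w b l ∧ ∀ v ∈ l, v ∈ Insert.insert w R := by
    intro b hb
    obtain ⟨l, hl, hlR⟩ := hR s hs b hb
    refine ⟨w :: l, hl.cons hsw.symm fun h => hw (hlR w h), fun v hv => ?_⟩
    rcases List.mem_cons.1 hv with rfl | hv
    · exact Finset.mem_insert_self _ _
    · exact Finset.mem_insert_of_mem (hlR v hv)
  intro a ha b hb
  rcases Finset.mem_insert.1 ha with ha | ha <;> rcases Finset.mem_insert.1 hb with hb | hb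
  · exact ⟨[w], by rw [ha, hb]; exact isPathList_singleton _, by simp⟩
  · exact ha ▸ key b hb
  · rw [hb]
    obtain ⟨l, hl, hlR⟩ := key a ha
    exact ⟨_, hl.reverse, by simpa using hlR⟩
  · obtain ⟨l, hl, hlR⟩ := hR a ha b hb
    exact ⟨l, hl, fun v hv => Finset.mem_insert_of_mem (hlR v hv)⟩

theorem HasLongCycle.exists_hasCycleLen {n : ℕ} {G : SimpleGraph (Fin n)}
    (h : HasLongCycle G c) : ∃ ℓ, c < ℓ ∧ HasCycleLen G ℓ := by
  obtain ⟨x, y, l, ⟨h1, h2, h3, h4⟩, hyx, hcl⟩ := h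
  refine ⟨l.length, hcl, fun i => l[i], List.nodup_iff_injective_get.1 h1, fun ⟨i, hi⟩ => ?_⟩
  rw [List.isChain_iff_getElem] at h2
  rw [List.head?_eq_getElem?, List.getElem?_eq_getElem (by omega), Option.some.injEq] at h3
  rw [List.getLast?_eq_getElem?, List.getElem?_eq_getElem (by omega), Option.some.injEq] at h4
  simp only [Fin.getElem_fin]
  rcases Nat.lt_or_ge (i + 1) l.length with hlt | hge
  · simp only [Nat.mod_eq_of_lt hlt]
    exact h2 i hlt
  · obtain rfl : i = l.length - 1 := by omega
    simp only [show l.length - 1 + 1 = l.length by omega, Nat.mod_self]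
    rw [h3, h4]
    exact hyx

end LongCycles

/-- Twice the number of edges of a disjoint union of cliques on `c` vertices and one clique on the
remaining vertices, with loops counted once, on `x` vertices in total. -/
def blockBound (c x : ℕ) : ℕ := x / c * c ^ 2 + (x % c) ^ 2

theorem blockBound_of_le {c x : ℕ} (hc : 0 < c) (h : x ≤ c) : blockBound c x = x ^ 2 := by
  rcases h.lt_or_eq with h | rfl
  · simp [blockBound, Nat.div_eq_of_lt h, Nat.mod_eq_of_lt h]
  · simp [blockBound, Nat.div_self hc]

theorem blockBound_add_le {c : ℕ} (hc : 0 < c) (a b : ℕ) :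
    blockBound c a + blockBound c b ≤ blockBound c (a + b) := by
  have ha := Nat.mod_lt a hc
  have hb := Nat.mod_lt b hc
  simp only [blockBound, Nat.add_div hc, Nat.add_mod a b c]
  split_ifs with h
  · obtain ⟨k, hk⟩ := Nat.exists_eq_add_of_le h
    have hk' : (a % c + b % c) % c = k := by
      rw [hk, Nat.add_mod_left, Nat.mod_eq_of_lt (by omega)]
    rw [hk']
    generalize a % c = p at *
    generalize b % c = q at *
    obtain ⟨i, rfl⟩ := Nat.exists_eq_add_of_lt ha
    obtain ⟨j, hj⟩ := Nat.exists_eq_add_of_lt hb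
    obtain rfl : p = k + j + 1 := by omega
    obtain rfl : q = k + i + 1 := by omega
    nlinarith [mul_nonneg i.zero_le j.zero_le]
  · rw [Nat.mod_eq_of_lt (by omega : a % c + b % c < c)]
    nlinarith [mul_nonneg (a % c).zero_le (b % c).zero_le]

theorem blockBound_mono {c : ℕ} (hc : 0 < c) : Monotone (blockBound c) := by
  intro a b hab
  obtain ⟨k, rfl⟩ := Nat.exists_eq_add_of_le hab
  exact (Nat.le_add_right _ _).trans (blockBound_add_le hc a k)

theorem sq_le_blockBound {c x : ℕ} (hc : 0 < c) (h : c ≤ x) : c ^ 2 ≤ blockBound c x :=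
  (blockBound_of_le hc le_rfl).symm.trans_le (blockBound_mono hc h)

theorem four_mul_mul_le_blockBound (c x : ℕ) : 4 * (c * x) ≤ 4 * blockBound c x + c ^ 2 := by
  have h := Nat.div_add_mod x c
  zify [blockBound] at *
  nth_rewrite 1 [← h]
  nlinarith [sq_nonneg ((c : ℤ) - 2 * (x % c))]

theorem blockBound_le (c x t : ℕ) :
    (blockBound c x : ℝ) ≤ t * (c : ℝ) ^ 2 + ((x : ℝ) - t * c) ^ 2 := by
  rcases Nat.eq_zero_or_pos c with rfl | hc
  · simp [blockBound]
  have h := Nat.div_add_mod x c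
  have hr := Nat.mod_lt x hc
  suffices (blockBound c x : ℤ) ≤ t * (c : ℤ) ^ 2 + ((x : ℤ) - t * c) ^ 2 by exact_mod_cast this
  rw [blockBound]
  generalize x / c = q at *
  generalize x % c = r at *
  subst h
  push_cast
  have hr' : (r : ℤ) < c := by exact_mod_cast hr
  have hr0 : (0 : ℤ) ≤ r := Int.natCast_nonneg r
  have hc0 : (0 : ℤ) < c := by exact_mod_cast hc
  obtain ⟨d, hd⟩ : ∃ d : ℤ, d = q - t := ⟨_, rfl⟩
  have hq : (q : ℤ) = d + t := by omega
  rw [hq]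
  have key : 0 ≤ d * ((d - 1) * c + 2 * r) := by
    rcases lt_trichotomy d 0 with h | rfl | h
    · refine mul_nonneg_of_nonpos_of_nonpos h.le ?_
      nlinarith
    · simp
    · exact mul_nonneg h.le (by nlinarith)
  nlinarith [mul_nonneg hc0.le key]

section EdgeCount

variable {V : Type*} {G H : SimpleGraph V} {A B S T : Finset V} {v : V} {s t : ℕ}

open Classical in
/-- The number of neighbours of `v` in `A`. -/
noncomputable def degIn (G : SimpleGraph V) (A : Finset V) (v : V) : ℕ :=
  (A.filter (G.Adj v)).card

/-- The number of pairs in `A × B` that are edges of `G`. -/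
noncomputable def edgeCount (G : SimpleGraph V) (A B : Finset V) : ℕ :=
  ∑ a ∈ A, degIn G B a

theorem edgeCount_comm : edgeCount G A B = edgeCount G B A := by
  classical
  simp only [edgeCount, degIn, Finset.card_filter]
  rw [Finset.sum_comm]
  exact Finset.sum_congr rfl fun b _ => Finset.sum_congr rfl fun a _ => by
    rw [if_congr (G.adj_comm a b) rfl rfl]

theorem edgeCount_congr (h : ∀ a ∈ A, ∀ b ∈ B, (G.Adj a b ↔ H.Adj a b)) :
    edgeCount G A B = edgeCount H A B := by
  classical
  exact Finset.sum_congr rfl fun a ha =>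
    congrArg Finset.card (Finset.filter_congr fun b hb => h a ha b hb)

theorem degIn_le_card : degIn G A v ≤ A.card := by
  classical exact Finset.card_filter_le _ _

theorem degIn_mono (h : A ⊆ B) : degIn G A v ≤ degIn G B v := by
  classical exact Finset.card_le_card (Finset.filter_subset_filter _ h)

theorem degIn_lt_card (hv : v ∈ A) : degIn G A v < A.card := by
  classical
  exact Finset.card_lt_card
    ⟨Finset.filter_subset _ _, fun h => G.irrefl (Finset.mem_filter.1 (h hv)).2⟩

theorem edgeCount_le_mul : edgeCount G A B ≤ A.card * B.card :=
  (Finset.sum_le_card_nsmul _ _ _ fun _ _ => degIn_le_card).trans_eq (smul_eq_mul ..)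

theorem edgeCount_mono_graph (h : G ≤ H) : edgeCount G A B ≤ edgeCount H A B := by
  classical
  exact Finset.sum_le_sum fun a _ =>
    Finset.card_le_card (Finset.monotone_filter_right _ fun b _ hb => h hb)

theorem edgeCount_union [DecidableEq V] (h : Disjoint A B) :
    edgeCount G (A ∪ B) (A ∪ B) =
      edgeCount G A A + edgeCount G B B + 2 * edgeCount G A B := by
  have h1 : ∀ C, edgeCount G (A ∪ B) C = edgeCount G A C + edgeCount G B C := fun C =>
    Finset.sum_union h
  rw [h1, edgeCount_comm (A := A) (B := A ∪ B), edgeCount_comm (A := B) (B := A ∪ B), h1, h1,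
    edgeCount_comm (A := B) (B := A)]
  ring

theorem edgeCount_erase [DecidableEq V] (hv : v ∈ S) :
    edgeCount G S S = edgeCount G (S.erase v) (S.erase v) + 2 * degIn G S v := by
  have h := edgeCount_union (G := G) (A := {v}) (B := S.erase v) (by simp)
  rw [← Finset.insert_eq, Finset.insert_erase hv] at h
  rw [h]
  have e1 : edgeCount G {v} {v} = 0 := by simp [edgeCount, degIn]
  have e2 : edgeCount G {v} (S.erase v) = degIn G S v := by
    rw [edgeCount, Finset.sum_singleton, degIn, degIn, Finset.filter_erase,
      Finset.erase_eq_of_notMem (by simp)]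
  rw [e1, e2]
  ring

/-- Vertices outside `T` of small degree can be removed one after the other. -/
theorem exists_subset_degIn_lt (hT : T ⊆ S) (s : ℕ) :
    ∃ A, T ⊆ A ∧ A ⊆ S ∧ edgeCount G S S ≤ edgeCount G A A + 2 * s * (S.card - A.card) ∧
      ∀ v ∈ A, v ∉ T → s < degIn G A v := by
  classical
  induction S using Finset.strongInduction with
  | H S ih =>
    by_cases h : ∃ v ∈ S, v ∉ T ∧ degIn G S v ≤ s
    · obtain ⟨v, hv, hvT, hs⟩ := h
      obtain ⟨A, h1, h2, h3, h4⟩ := ih _ (Finset.erase_ssubset hv)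
        (Finset.subset_erase.2 ⟨hT, hvT⟩)
      refine ⟨A, h1, h2.trans (Finset.erase_subset _ _), ?_, h4⟩
      rw [edgeCount_erase hv]
      have hA := Finset.card_le_card h2
      have hcard := Finset.card_erase_add_one hv
      obtain ⟨k, hk⟩ := Nat.exists_eq_add_of_le hA
      rw [hk, Nat.add_sub_cancel_left] at h3
      rw [← hcard, hk, show A.card + k + 1 - A.card = k + 1 by omega]
      nlinarith
    · push Not at h
      exact ⟨S, hT, subset_rfl, by simp, h⟩

theorem edgeCount_le_of_degenerate (hS : ∀ A ⊆ S, A.Nonempty → ∃ v ∈ A, degIn G A v ≤ t)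
    (ht : t ≤ S.card) : edgeCount G S S ≤ t ^ 2 + 2 * t * (S.card - t) := by
  classical
  induction S using Finset.strongInduction with
  | H S ih =>
    rcases ht.lt_or_eq with hlt | heq
    · obtain ⟨v, hv, hd⟩ := hS S subset_rfl (Finset.card_pos.1 (by omega))
      have hcard := Finset.card_erase_add_one hv
      have := ih _ (Finset.erase_ssubset hv)
        (fun A hA => hS A (hA.trans (Finset.erase_subset _ _))) (by omega)
      rw [edgeCount_erase hv]
      obtain ⟨k, hk⟩ := Nat.exists_eq_add_of_lt hlt
      rw [show (S.erase v).card - t = k by omega] at this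
      rw [show S.card - t = k + 1 by omega]
      nlinarith
    · rw [← heq]
      refine edgeCount_le_mul.trans_eq ?_
      rw [← heq]
      simp [sq]

end EdgeCount

section Saturated

variable {V : Type*} {G : SimpleGraph V} {c : ℕ} {A B S : Finset V} {x y u₁ u₂ : V}

theorem exists_maximal_not_hasLongCycle [Finite V] (hc : 2 ≤ c) (hG : ¬ HasLongCycle G c) :
    ∃ H, G ≤ H ∧ ¬ HasLongCycle H c ∧
      ∀ x y, x ≠ y → ¬ H.Adj x y → ∃ l, IsPathList H x y l ∧ c < l.length := by
  obtain ⟨H, hGH, hmax⟩ := (Set.toFinite {H | ¬ HasLongCycle H c}).exists_le_maximal hG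
  refine ⟨H, hGH, hmax.prop, fun x y hxy hadj => ?_⟩
  refine exists_path_of_hasLongCycle_sup_edge hc hmax.prop ?_
  by_contra hcon
  refine hadj (hmax.2 (y := H ⊔ SimpleGraph.edge x y) hcon le_sup_left (Or.inr ?_))
  simp [SimpleGraph.edge_adj, hxy]

/-- In a graph where non-adjacent vertices are joined by long paths but there is no long cycle,
two sets with large inner degrees are completely joined. -/
theorem adj_of_degIn [Finite V] (hG : ¬ HasLongCycle G c)
    (hsat : ∀ x y, x ≠ y → ¬ G.Adj x y → ∃ l, IsPathList G x y l ∧ c < l.length)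
    (hu : u₁ ≠ u₂) (hA₁ : ∀ a ∈ A, G.Adj u₁ a) (hA₂ : ∀ a ∈ A, G.Adj u₂ a)
    (hB₁ : ∀ b ∈ B, G.Adj u₁ b) (hB₂ : ∀ b ∈ B, G.Adj u₂ b) {p q : ℕ}
    (hp : ∀ a ∈ A, p ≤ degIn G A a) (hq : ∀ b ∈ B, q ≤ degIn G B b) (hpq : c < p + q)
    (hx : x ∈ A) (hy : y ∈ B) (hxy : x ≠ y) : G.Adj x y := by
  classical
  by_contra hadj
  have key : ∀ k, ∃ x ∈ A, ∃ y ∈ B, ∃ l, IsPathList G x y l ∧ c < l.length ∧ k ≤ l.length := by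
    intro k
    induction k with
    | zero =>
      obtain ⟨l, hl, hcl⟩ := hsat x y hxy hadj
      exact ⟨x, hx, y, hy, l, hl, hcl, Nat.zero_le _⟩
    | succ k ih =>
      obtain ⟨x, hx, y, hy, l, hl, hcl, hkl⟩ := ih
      by_cases hxl : ∀ z ∈ A, G.Adj x z → z ∈ l
      swap
      · push Not at hxl
        obtain ⟨z, hz, hxz, hzl⟩ := hxl
        exact ⟨z, hz, y, hy, z :: l, hl.cons hxz.symm hzl, by simp; omega, by simpa⟩
      by_cases hyl : ∀ z ∈ B, G.Adj y z → z ∈ l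
      swap
      · push Not at hyl
        obtain ⟨z, hz, hyz, hzl⟩ := hyl
        exact ⟨x, hx, z, hz, _, (hl.reverse.cons hyz.symm (by simpa)).reverse,
          by simp; omega, by simpa⟩
      exfalso
      have hmem : ∀ u, G.Adj u x → G.Adj u y → u ∈ l := by
        intro u hux huy
        by_contra hul
        exact hG ⟨_, _, _, hl.cons hux hul, huy.symm, by simp; omega⟩
      refine hG (hasLongCycle_of_degree_sum hl hcl hu (hmem _ (hA₁ x hx) (hB₁ y hy))
        (hmem _ (hA₂ x hx) (hB₂ y hy)) (hA₁ x hx).symm (hA₂ x hx).symm (hB₁ y hy).symm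
        (hB₂ y hy).symm ?_)
      have h1 : degIn G A x ≤ (l.toFinset.filter (G.Adj x)).card := by
        rw [degIn]
        refine Finset.card_le_card fun z hz => ?_
        simp only [Finset.mem_filter, List.mem_toFinset] at hz ⊢
        exact ⟨hxl z hz.1 hz.2, hz.2⟩
      have h2 : degIn G B y ≤ (l.toFinset.filter (G.Adj y)).card := by
        rw [degIn]
        refine Finset.card_le_card fun z hz => ?_
        simp only [Finset.mem_filter, List.mem_toFinset] at hz ⊢
        exact ⟨hyl z hz.1 hz.2, hz.2⟩
      convert hpq.trans_le (add_le_add ((hp x hx).trans h1) ((hq y hy).trans h2))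
  have := Fintype.ofFinite V
  obtain ⟨x, -, y, -, l, hl, -, hlen⟩ := key (Fintype.card V + 1)
  have := hl.1.length_le_card
  omega

/-- The edge bound inside a set completely joined to two vertices, in a graph without long
cycles. -/
theorem edgeCount_le_of_universal_pair [Finite V] (hc : 2 ≤ c) (hG : ¬ HasLongCycle G c)
    (hu : u₁ ≠ u₂) (hS₁ : ∀ a ∈ S, G.Adj u₁ a) (hS₂ : ∀ a ∈ S, G.Adj u₂ a) :
    edgeCount G S S ≤ blockBound c S.card + 2 * S.card := by
  classical
  have hc0 : 0 < c := by omega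
  rcases le_or_gt S.card c with hcard | hcard
  · rw [blockBound_of_le hc0 hcard]
    have := edgeCount_le_mul (G := G) (A := S) (B := S)
    nlinarith
  obtain ⟨H, hGH, hH, hsat⟩ := exists_maximal_not_hasLongCycle hc hG
  refine (edgeCount_mono_graph hGH).trans ?_
  replace hS₁ : ∀ a ∈ S, H.Adj u₁ a := fun a ha => hGH (hS₁ a ha)
  replace hS₂ : ∀ a ∈ S, H.Adj u₂ a := fun a ha => hGH (hS₂ a ha)
  have hf₁ := sq_le_blockBound hc0 hcard.le
  have hf₂ := four_mul_mul_le_blockBound c S.card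
  obtain ⟨t, ht⟩ : ∃ t, t = c / 2 := ⟨_, rfl⟩
  by_cases hdeg : ∀ A ⊆ S, A.Nonempty → ∃ v ∈ A, degIn H A v ≤ t
  · refine (edgeCount_le_of_degenerate hdeg (by omega)).trans ?_
    generalize blockBound c S.card = f at *
    obtain ⟨k, hk⟩ := Nat.exists_eq_add_of_lt hcard
    rw [hk] at hf₂ ⊢
    rcases (show c = 2 * t ∨ c = 2 * t + 1 by omega) with h | h
    · rw [show c + k + 1 - t = t + k + 1 by omega]
      subst h
      nlinarith
    · rw [show c + k + 1 - t = t + k + 2 by omega]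
      subst h
      nlinarith
  push Not at hdeg
  let F := S.powerset.filter fun A => A.Nonempty ∧ ∀ v ∈ A, t < degIn H A v
  have hF : F.Nonempty := by
    obtain ⟨A, h1, h2, h3⟩ := hdeg
    exact ⟨A, by simpa [F] using ⟨h1, h2, h3⟩⟩
  obtain ⟨K, hKF, hKmax⟩ := F.exists_max_image Finset.card hF
  simp only [F, Finset.mem_filter, Finset.mem_powerset] at hKF hKmax
  obtain ⟨hKS, ⟨v₀, hv₀⟩, hKdeg⟩ := hKF
  have hS₁K : ∀ a ∈ K, H.Adj u₁ a := fun a ha => hS₁ a (hKS ha)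
  have hS₂K : ∀ a ∈ K, H.Adj u₂ a := fun a ha => hS₂ a (hKS ha)
  have hclique : ∀ x ∈ K, ∀ y ∈ K, x ≠ y → H.Adj x y := fun x hx y hy hxy =>
    adj_of_degIn hH hsat hu hS₁K hS₂K hS₁K hS₂K hKdeg hKdeg (by omega) hx hy hxy
  have hKdeg' : ∀ v ∈ K, K.card - 1 ≤ degIn H K v := by
    intro v hv
    rw [← Finset.card_erase_of_mem hv]
    refine Finset.card_le_card fun z hz => ?_
    rw [Finset.mem_erase] at hz
    exact Finset.mem_filter.2 ⟨hz.2, hclique v hv z hz.2 hz.1.symm⟩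
  have hKt : t + 2 ≤ K.card := by
    have := hKdeg v₀ hv₀
    have := degIn_lt_card (G := H) hv₀
    omega
  have hKc : K.card ≤ c := by
    by_contra hcon
    have hpos : 0 < K.toList.length := by rw [Finset.length_toList]; omega
    have hnd := K.nodup_toList
    have hlen := K.length_toList
    have hmem : ∀ i (hi : i < K.toList.length), K.toList[i] ∈ K := fun i hi =>
      Finset.mem_toList.1 (List.getElem_mem hi)
    refine hH ⟨K.toList[0], K.toList[K.toList.length - 1], K.toList, ⟨hnd, ?_, ?_, ?_⟩,
      hclique _ (hmem _ _) _ (hmem _ _) ?_, by omega⟩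
    · rw [List.isChain_iff_getElem]
      intro i hi
      refine hclique _ (hmem _ _) _ (hmem _ _) fun e => ?_
      have := hnd.getElem_inj_iff.1 e
      omega
    · rw [List.head?_eq_getElem?, List.getElem?_eq_getElem]
    · rw [List.getLast?_eq_getElem?, List.getElem?_eq_getElem]
    · intro e
      have := hnd.getElem_inj_iff.1 e
      omega
  obtain ⟨A, hKA, hAS, hA, hAdeg⟩ := exists_subset_degIn_lt (G := H) hKS (c - K.card + 1)
  have hAK : A = K := by
    by_contra hne
    obtain ⟨y, hyA, hyK⟩ : ∃ y ∈ A, y ∉ K := by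
      by_contra hcon
      push Not at hcon
      exact hne (Finset.Subset.antisymm hcon hKA)
    have hjoin : ∀ x ∈ K, H.Adj x y := fun x hx =>
      adj_of_degIn hH hsat hu hS₁K hS₂K (fun b hb => hS₁ b (hAS hb)) (fun b hb => hS₂ b (hAS hb))
        hKdeg' (q := c - K.card + 2)
        (fun b hb => by
          by_cases hbK : b ∈ K
          · have := hKdeg b hbK
            have := degIn_mono (G := H) (v := b) hKA
            omega
          · have := hAdeg b hb hbK
            omega)
        (by omega) hx hyA (fun e => hyK (e ▸ hx))
    have hsub : K ⊆ insert y K := Finset.subset_insert _ _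
    have hins := hKmax (insert y K) ⟨Finset.insert_subset (hAS hyA) hKS, ⟨y, by simp⟩, ?_⟩
    · rw [Finset.card_insert_of_notMem hyK] at hins
      omega
    · intro v hv
      rcases Finset.mem_insert.1 hv with rfl | hv
      · have : K.card ≤ degIn H (insert v K) v :=
          Finset.card_le_card fun z hz => Finset.mem_filter.2 ⟨hsub hz, (hjoin z hz).symm⟩
        omega
      · exact (hKdeg v hv).trans_le (degIn_mono hsub)
  subst hAK
  have hAA := edgeCount_le_mul (G := H) (A := A) (B := A)
  refine hA.trans ?_
  generalize blockBound c S.card = f at *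
  generalize edgeCount H A A = e at *
  generalize A.card = h at *
  obtain ⟨a, rfl⟩ := Nat.exists_eq_add_of_le hKc
  obtain ⟨k, hk⟩ := Nat.exists_eq_add_of_lt hcard
  rw [hk] at hf₂ ⊢
  rw [show h + a - h = a by omega, show h + a + k + 1 - h = a + k + 1 by omega]
  have hah : a ≤ h := by omega
  obtain ⟨b, rfl⟩ := Nat.exists_eq_add_of_le hah
  have hq : (a + b) ^ 2 + 2 * (a + k + 1) * a ≤ f := by
    refine Nat.le_of_mul_le_mul_left ?_ hc0
    nlinarith [Nat.mul_le_mul_left b hf₁, Nat.mul_le_mul_left a hf₂,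
      Nat.zero_le (a * b * (a + b + a))]
  nlinarith

end Saturated

section Reservoir

variable {V : Type*} {G : SimpleGraph V} {S : Finset V}

/-- If no cut of `S` is sparse, a small connected set dominates almost all of `S`. -/
theorem exists_connectedIn_dominating [DecidableEq V] {δ : ℝ} (hδ : δ ≤ 1) (hS : S.Nonempty)
    (hcut : ∀ A B, Disjoint A B → A ∪ B = S → A.Nonempty → B.Nonempty →
      δ * A.card * B.card < edgeCount G A B) (k : ℕ) :
    ∃ R X, R ⊆ S ∧ X ⊆ S ∧ Disjoint R X ∧ R.Nonempty ∧ ConnectedIn G R ∧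
      (∀ v ∈ S, v ∉ R → v ∉ X → ∃ s ∈ R, G.Adj s v) ∧ R.card ≤ k + 1 ∧
      (X.card : ℝ) ≤ (1 - δ) ^ k * S.card := by
  classical
  induction k with
  | zero =>
    obtain ⟨v, hv⟩ := hS
    refine ⟨{v}, S.erase v, by simpa using hv, Finset.erase_subset _ _, by simp, by simp, ?_,
      fun u hu hne hX => ?_, by simp, ?_⟩
    · intro a ha b hb
      rw [Finset.mem_singleton] at ha hb
      subst ha hb
      exact ⟨[_], isPathList_singleton _, by simp⟩
    · simp_all
    · simpa using Finset.card_erase_le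
  | succ k ih =>
    obtain ⟨R, X, hRS, hXS, hRX, hR, hconn, hdom, hRcard, hXcard⟩ := ih
    have hRA : R ⊆ S \ X := fun v hv =>
      Finset.mem_sdiff.2 ⟨hRS hv, Finset.disjoint_left.1 hRX hv⟩
    rcases X.eq_empty_or_nonempty with rfl | hX
    · refine ⟨R, ∅, hRS, hXS, hRX, hR, hconn, hdom, by omega, ?_⟩
      have : 0 ≤ 1 - δ := by linarith
      simp only [Finset.card_empty, Nat.cast_zero]
      positivity
    have hsum := hcut (S \ X) X Finset.sdiff_disjoint (Finset.sdiff_union_of_subset hXS)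
      (hR.mono hRA) hX
    obtain ⟨w, hwA, hw⟩ : ∃ w ∈ S \ X, δ * X.card < degIn G X w := by
      apply Finset.exists_lt_of_sum_lt
      rw [Finset.sum_const, nsmul_eq_mul]
      calc _ = δ * (S \ X).card * X.card := by ring
        _ < _ := hsum
        _ = _ := by simp [edgeCount]
    obtain ⟨hwS, hwX⟩ := Finset.mem_sdiff.1 hwA
    refine ⟨insert w R, X.filter (fun v => ¬ G.Adj w v), Finset.insert_subset hwS hRS,
      (Finset.filter_subset _ _).trans hXS, ?_, Finset.insert_nonempty _ _, ?_, ?_, ?_, ?_⟩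
    · rw [Finset.disjoint_insert_left]
      exact ⟨fun h => hwX (Finset.mem_filter.1 h).1,
        hRX.mono_right (Finset.filter_subset _ _)⟩
    · by_cases hwR : w ∈ R
      · rwa [Finset.insert_eq_of_mem hwR]
      · obtain ⟨s, hs, hsw⟩ := hdom w hwS hwR hwX
        exact hconn.insert hs hsw
    · intro v hv hvR hvX
      by_cases hX' : v ∈ X
      · refine ⟨w, Finset.mem_insert_self _ _, ?_⟩
        by_contra hadj
        exact hvX (Finset.mem_filter.2 ⟨hX', hadj⟩)
      · obtain ⟨s, hs, hsv⟩ := hdom v hv (fun h => hvR (Finset.mem_insert_of_mem h)) hX'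
        exact ⟨s, Finset.mem_insert_of_mem hs, hsv⟩
    · have := Finset.card_insert_le w R
      omega
    · have hsplit := X.card_filter_add_card_filter_not (fun v => G.Adj w v)
      have hdeg : degIn G X w = (X.filter (fun v => G.Adj w v)).card := by
        rw [degIn]
      rw [← hdeg] at hsplit
      have hsplit' : (degIn G X w : ℝ) + (X.filter (fun v => ¬ G.Adj w v)).card = X.card := by
        exact_mod_cast hsplit
      have := mul_le_mul_of_nonneg_left hXcard (by linarith : 0 ≤ 1 - δ)
      rw [pow_succ']
      linarith

/-- Asymptotic bound on the number of edges inside `S` in a graph without long cycles in which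
`k` vertices are adjacent to all of `S`. -/
def LongCycleBound (k : ℕ) : Prop :=
  ∀ ε : ℝ, 0 < ε → ∃ N₀ : ℕ, ∀ N ≥ N₀, ∀ (V : Type) [Finite V] (G : SimpleGraph V) (c : ℕ)
    (U S : Finset V), 2 ≤ c → ¬ HasLongCycle G c → U.card = k → Disjoint U S →
    (∀ u ∈ U, ∀ a ∈ S, G.Adj u a) → S.card ≤ N →
    (edgeCount G S S : ℝ) ≤ blockBound c S.card + ε * N * S.card

theorem longCycleBound_two : LongCycleBound 2 := by
  classical
  intro ε hε
  refine ⟨⌈2 / ε⌉₊, fun N hN V _ G c U S hc hG hU hUS hadj hS => ?_⟩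
  obtain ⟨u₁, u₂, hu, rfl⟩ := Finset.card_eq_two.1 hU
  have h := edgeCount_le_of_universal_pair hc hG hu (hadj u₁ (by simp)) (hadj u₂ (by simp))
  have hN' : 2 ≤ ε * N := by
    have := (Nat.le_ceil _).trans (Nat.cast_le (α := ℝ).2 hN)
    rw [div_le_iff₀ hε] at this
    linarith
  have h' : (edgeCount G S S : ℝ) ≤ blockBound c S.card + 2 * S.card := by exact_mod_cast h
  have := mul_le_mul_of_nonneg_right hN' (Nat.cast_nonneg (α := ℝ) S.card)
  linarith

theorem edgeCount_le_add_of_subset {A : Finset V} (hA : A ⊆ S) :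
    edgeCount G S S ≤ edgeCount G A A + 2 * (S.card - A.card) * S.card := by
  classical
  have h := edgeCount_union (G := G) (A := A) (B := S \ A) Finset.disjoint_sdiff
  rw [Finset.union_sdiff_of_subset hA] at h
  have h1 := edgeCount_le_mul (G := G) (A := A) (B := S \ A)
  have h2 := edgeCount_le_mul (G := G) (A := S \ A) (B := S \ A)
  rw [Finset.card_sdiff_of_subset hA] at h1 h2
  obtain ⟨k, hk⟩ := Nat.exists_eq_add_of_le (Finset.card_le_card hA)
  rw [h, hk]
  rw [hk, Nat.add_sub_cancel_left] at h1 h2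
  rw [Nat.add_sub_cancel_left]
  nlinarith

/-- A universal vertex can be dispensed with: split along sparse cuts, and in each remaining piece
contract a small connected set dominating almost all of it. -/
theorem LongCycleBound.of_succ {k : ℕ} (hk : LongCycleBound (k + 1)) : LongCycleBound k := by
  classical
  intro ε hε
  obtain ⟨δ, hδ0, hδ1, hδε⟩ : ∃ δ : ℝ, 0 < δ ∧ δ ≤ 1 ∧ δ ≤ ε / 2 :=
    ⟨min 1 (ε / 2), by positivity, min_le_left _ _, min_le_right _ _⟩
  obtain ⟨j, hj⟩ := exists_pow_lt_of_lt_one (by positivity : 0 < ε / 16)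
    (by linarith : 1 - δ < 1)
  obtain ⟨N₁, hN₁⟩ := hk (ε / 4) (by positivity)
  refine ⟨max N₁ ⌈16 * (j + 1) / ε⌉₊, fun N hN V _ G c U S hc hG hU hUS hadj hS => ?_⟩
  have hNN₁ := (le_max_left _ _).trans hN
  have hNj : 16 * (j + 1) ≤ ε * N := by
    have := (Nat.le_ceil _).trans (Nat.cast_le (α := ℝ).2 ((le_max_right _ _).trans hN))
    rw [div_le_iff₀ hε] at this
    linarith
  have hc0 : 0 < c := by omega
  have key : (edgeCount G S S : ℝ) ≤
      blockBound c S.card + ε / 2 * N * S.card + δ * (S.card : ℝ) ^ 2 := by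
    induction S using Finset.strongInduction with
    | H S ih =>
      rcases S.eq_empty_or_nonempty with rfl | hSne
      · simp [edgeCount]
      by_cases hcut : ∀ A B, Disjoint A B → A ∪ B = S → A.Nonempty → B.Nonempty →
          δ * A.card * B.card < edgeCount G A B
      · obtain ⟨R, X, hRS, hXS, -, ⟨r, hr⟩, hconn, hdom, hRcard, hXcard⟩ :=
          exists_connectedIn_dominating hδ1 hSne hcut j
        let A := S \ (R ∪ X)
        have hAS : A ⊆ S := Finset.sdiff_subset
        have hAR : ∀ a ∈ A, a ∉ R := fun a ha h =>
          (Finset.mem_sdiff.1 ha).2 (Finset.mem_union_left _ h)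
        have hUR : ∀ u ∈ U, u ∉ R := fun u hu h => Finset.disjoint_left.1 hUS hu (hRS h)
        have hAcard := Finset.card_le_card hAS
        have hbound := hN₁ N hNN₁ V (contract G R r) c (insert r U) A hc
          (fun h => hG (hasLongCycle_of_contract hconn hr h (by omega)))
          (by rw [Finset.card_insert_of_notMem fun h => hUR r h hr, hU])
          (by
            rw [Finset.disjoint_insert_left]
            exact ⟨fun h => hAR r h hr, hUS.mono_right hAS⟩)
          (by
            intro u hu a ha
            rcases Finset.mem_insert.1 hu with rfl | hu
            · exact (contract_adj_left hr).2 ⟨hAR a ha, hdom a (hAS ha) (hAR a ha) fun h =>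
                (Finset.mem_sdiff.1 ha).2 (Finset.mem_union_right _ h)⟩
            · exact (contract_adj_of_notMem (hUR u hu) (hAR a ha) hr).2 (hadj u hu a (hAS ha)))
          (hAcard.trans hS)
        rw [edgeCount_congr fun a ha b hb => contract_adj_of_notMem (hAR a ha) (hAR b hb) hr]
          at hbound
        have hrem : S.card - A.card ≤ R.card + X.card := by
          rw [← Finset.card_sdiff_of_subset hAS, Finset.sdiff_sdiff_eq_self
            (Finset.union_subset hRS hXS)]
          exact Finset.card_union_le _ _
        have hedge := (edgeCount_le_add_of_subset (G := G) hAS).trans (Nat.add_le_add_left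
          (Nat.mul_le_mul_right _ (Nat.mul_le_mul_left 2 hrem)) _)
        have hedge' : (edgeCount G S S : ℝ) ≤
            edgeCount G A A + 2 * (R.card + X.card) * S.card := by exact_mod_cast hedge
        have hmono : (blockBound c A.card : ℝ) ≤ blockBound c S.card := by
          exact_mod_cast blockBound_mono hc0 hAcard
        have hRcard' : (R.card : ℝ) ≤ j + 1 := by exact_mod_cast hRcard
        have hSN : (S.card : ℝ) ≤ N := by exact_mod_cast hS
        have hAS' : (A.card : ℝ) ≤ S.card := by exact_mod_cast hAcard
        have hS0 : (0 : ℝ) ≤ S.card := Nat.cast_nonneg _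
        have hX' : (X.card : ℝ) ≤ ε / 16 * N :=
          hXcard.trans (mul_le_mul hj.le hSN hS0 (by positivity))
        have h1 : 2 * ((R.card : ℝ) + X.card) * S.card ≤ ε / 4 * N * S.card :=
          mul_le_mul_of_nonneg_right (by linarith) hS0
        have h2 : ε / 4 * N * A.card ≤ ε / 4 * N * S.card :=
          mul_le_mul_of_nonneg_left hAS' (by positivity)
        have h3 : 0 ≤ δ * (S.card : ℝ) ^ 2 := by positivity
        linarith
      · push Not at hcut
        obtain ⟨A, B, hAB, rfl, hA, hB, hsparse⟩ := hcut
        have hsub : ∀ C, C ⊆ A ∪ B → C ≠ A ∪ B → (edgeCount G C C : ℝ) ≤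
            blockBound c C.card + ε / 2 * N * C.card + δ * (C.card : ℝ) ^ 2 := fun C hC hne =>
          ih C (hC.ssubset_of_ne hne) (hUS.mono_right hC) (fun u hu a ha => hadj u hu a (hC ha))
            ((Finset.card_le_card hC).trans hS)
        have hcard := Finset.card_union_of_disjoint hAB
        have hApos := hA.card_pos
        have hBpos := hB.card_pos
        have h1 := hsub A Finset.subset_union_left fun e => by
          have := congrArg Finset.card e
          omega
        have h2 := hsub B Finset.subset_union_right fun e => by
          have := congrArg Finset.card e
          omega
        have h3 : (blockBound c A.card : ℝ) + blockBound c B.card ≤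
            blockBound c (A.card + B.card) := by exact_mod_cast blockBound_add_le hc0 _ _
        rw [edgeCount_union hAB, hcard]
        push_cast
        linarith
  have hSN : (S.card : ℝ) ≤ N := by exact_mod_cast hS
  have h1 : δ * (S.card : ℝ) ^ 2 ≤ ε / 2 * (N * S.card) := by
    rw [sq]
    gcongr
  linarith

end Reservoir

/-- Asymptotic version of Woodall's theorem. -/
theorem woodall_asymptotic (α : ℝ) (hα0 : 0 < α) (hα1 : α < 1) (β : ℝ) (hβ : 0 < β) :
    ∃ n₀ : ℕ, ∀ n : ℕ, n₀ < n → ∀ (G : SimpleGraph (Fin n)) [DecidableRel G.Adj],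
      (Nat.choose n 2 : ℝ) * (1 - (1 - w α) * (α + w α) + β) ≤ (G.edgeFinset.card : ℝ) →
      ∃ ℓ : ℕ, (1 - α) * (n : ℝ) ≤ (ℓ : ℝ) ∧ HasCycleLen G ℓ := by
  obtain ⟨γ, hγ⟩ : ∃ γ, γ = 1 - α := ⟨_, rfl⟩
  have hγ0 : 0 < γ := by linarith
  obtain ⟨t, ht⟩ := Int.eq_ofNat_of_zero_le (Int.floor_nonneg.2 (inv_nonneg.2 hγ0.le))
  have hw : w α = 1 - γ * t := by rw [w, ← hγ, ht]; simp
  have hw0 : 0 ≤ w α := by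
    have h : (t : ℝ) ≤ γ⁻¹ := by
      have := Int.floor_le γ⁻¹
      rw [ht] at this
      exact_mod_cast this
    have := mul_le_mul_of_nonneg_left h hγ0.le
    rw [mul_inv_cancel₀ hγ0.ne'] at this
    linarith
  obtain ⟨N₀, hN₀⟩ := longCycleBound_two.of_succ.of_succ (β / 2) (by positivity)
  obtain ⟨K, hK⟩ : ∃ K, K = γ * (1 - w α) + w α ^ 2 + β + 2 * w α * t + t ^ 2 := ⟨_, rfl⟩
  refine ⟨max N₀ (max ⌈3 / γ⌉₊ ⌈2 * K / β⌉₊), fun n hn G _ hE => ?_⟩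
  by_contra hno
  push Not at hno
  have hn1 : N₀ < n := (le_max_left _ _).trans_lt hn
  have hn2 : 3 ≤ γ * n := by
    have := (Nat.le_ceil _).trans (Nat.cast_le (α := ℝ).2
      (((le_max_left _ _).trans (le_max_right _ _)).trans hn.le))
    rw [div_le_iff₀ hγ0] at this
    linarith
  have hn3 : 2 * K < β * n := by
    have := (Nat.le_ceil _).trans_lt (Nat.cast_lt (α := ℝ).2
      (((le_max_right _ _).trans (le_max_right _ _)).trans_lt hn))
    rw [div_lt_iff₀ hβ] at this
    linarith
  obtain ⟨c, hc⟩ : ∃ c, ⌈γ * n⌉₊ = c + 1 :=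
    Nat.exists_eq_succ_of_ne_zero (Nat.ceil_pos.2 (by linarith)).ne'
  have hc1 : γ * n ≤ c + 1 := by
    have := Nat.le_ceil (γ * n)
    rw [hc] at this
    exact_mod_cast this
  have hc2 : (c : ℝ) < γ * n := by
    rw [← Nat.lt_ceil]
    omega
  have hc3 : 2 ≤ c := by
    have : (2 : ℝ) ≤ c := by linarith
    exact_mod_cast this
  have hG : ¬ HasLongCycle G c := by
    intro h
    obtain ⟨ℓ, hℓ, hcyc⟩ := h.exists_hasCycleLen
    refine hno ℓ ?_ hcyc
    rw [← hγ]
    exact hc1.trans (by exact_mod_cast hℓ)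
  have hbound := hN₀ n hn1.le (Fin n) G c ∅ Finset.univ hc3 hG rfl (by simp) (by simp) (by simp)
  have hcount : edgeCount G Finset.univ Finset.univ = 2 * G.edgeFinset.card := by
    rw [← G.sum_degrees_eq_twice_card_edges, edgeCount]
    refine Finset.sum_congr rfl fun v _ => ?_
    rw [← G.card_neighborFinset_eq_degree, degIn]
    congr 1
    ext u
    simp
  have hblock := blockBound_le c n t
  rw [Finset.card_univ, Fintype.card_fin, hcount] at hbound
  push_cast at hbound
  have hn0 : (1 : ℝ) ≤ n := by
    have : 1 ≤ n := by omega
    exact_mod_cast this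
  have ht0 : (0 : ℝ) ≤ t := Nat.cast_nonneg t
  have h1 : t * (c : ℝ) ^ 2 ≤ t * (γ * n) ^ 2 := by gcongr
  have h2 : ((n : ℝ) - t * c) ^ 2 ≤ (w α * n + t) ^ 2 := by
    have ha := mul_le_mul_of_nonneg_left hc1 ht0
    have hb := mul_le_mul_of_nonneg_left hc2.le ht0
    have hwn : w α * n = n - t * (γ * n) := by rw [hw]; ring
    have := mul_nonneg hw0 (Nat.cast_nonneg (α := ℝ) n)
    apply pow_le_pow_left₀ <;> linarith
  rw [Nat.cast_choose_two] at hE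
  have hα : 1 - (1 - w α) * (α + w α) + β = γ * (1 - w α) + w α ^ 2 + β := by
    rw [hγ]; ring
  have htγ : t * γ ^ 2 = γ * (1 - w α) := by rw [hw]; ring
  rw [hα] at hE
  generalize w α = ω at *
  have h3 : t * (γ * n) ^ 2 = γ * (1 - ω) * n ^ 2 := by rw [← htγ]; ring
  have h4 : (t : ℝ) ^ 2 ≤ t ^ 2 * n := le_mul_of_one_le_right (by positivity) hn0
  have h5 := mul_lt_mul_of_pos_right hn3 (by linarith : (0 : ℝ) < n)
  nlinarith
end

section
/- Let G be a (p,r)-pseudorandom directed graph on n vertices. Then for every two disjoint nonempty sets A, B ⊆ V(G) with |A| ≤ |B|, the number of edges from A to B satisfies |e_G(A,B) − p|A||B|| ≤ r·|B|·√(pn). -/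
/-- Averaging: if every `a`-subset of `B` has weight at most `a * c` in absolute value,
then `B` has weight at most `|B| * c` in absolute value. -/
theorem Finset.abs_sum_le_card_mul_of_forall_card_eq {α : Type*} [DecidableEq α] (w : α → ℝ)
    (c : ℝ) {a : ℕ} (ha : 0 < a) (B : Finset α) (hB : a ≤ B.card)
    (h : ∀ S ⊆ B, S.card = a → |∑ x ∈ S, w x| ≤ a * c) :
    |∑ x ∈ B, w x| ≤ B.card * c := by
  obtain ⟨k, hk⟩ := Nat.exists_eq_add_of_le hB
  induction k generalizing B with
  | zero => simpa [hk] using h B subset_rfl hk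
  | succ k ih =>
    have hpos : (0 : ℝ) < (a + k : ℕ) := by positivity
    have hcard : (B.card : ℝ) = (a + k : ℕ) + 1 := by rw [hk]; push_cast; ring
    have herase : ∀ x ∈ B, |∑ y ∈ B.erase x, w y| ≤ (a + k : ℕ) * c := by
      intro x hx
      have hx' : (B.erase x).card = a + k := by rw [Finset.card_erase_of_mem hx]; omega
      rw [← hx']
      exact ih _ (by omega) (fun S hS => h S (hS.trans (B.erase_subset x))) hx'
    have hsum : ∑ x ∈ B, ∑ y ∈ B.erase x, w y = (a + k : ℕ) * ∑ x ∈ B, w x := by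
      rw [Finset.sum_congr rfl fun x hx => Finset.sum_erase_eq_sub hx,
        Finset.sum_sub_distrib, Finset.sum_const, nsmul_eq_mul, hcard]
      ring
    have hle : (a + k : ℕ) * |∑ x ∈ B, w x| ≤ (a + k : ℕ) * (B.card * c) := by
      calc (a + k : ℕ) * |∑ x ∈ B, w x| = |∑ x ∈ B, ∑ y ∈ B.erase x, w y| := by
            rw [hsum, abs_mul, abs_of_pos hpos]
        _ ≤ ∑ x ∈ B, |∑ y ∈ B.erase x, w y| := Finset.abs_sum_le_sum_abs _ _
        _ ≤ ∑ _x ∈ B, ((a + k : ℕ) * c : ℝ) := Finset.sum_le_sum herase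
        _ = (a + k : ℕ) * (B.card * c) := by
            rw [Finset.sum_const, nsmul_eq_mul]; ring
    exact le_of_mul_le_mul_left hle hpos

theorem eG_eq_sum_singleton {n : ℕ} (E : Finset (Fin n × Fin n)) (A B : Finset (Fin n)) :
    eG E A B = ∑ x ∈ B, eG E A {x} := by
  unfold eG
  rw [Finset.card_eq_sum_card_fiberwise (f := Prod.snd) (t := B)
    fun e he => (Finset.mem_filter.mp he).2.2]
  refine Finset.sum_congr rfl fun x hx => congrArg Finset.card ?_
  ext e
  simp only [Finset.mem_filter, Finset.mem_singleton]
  grind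

/-- In a `(p,r)`-pseudorandom digraph, the discrepancy bound extends to pairs of
disjoint sets of different sizes. -/
theorem pseudorandom_unequal_sets
    (n : ℕ) (E : Finset (Fin n × Fin n)) (hE : ∀ e ∈ E, e.1 ≠ e.2)
    (p r : ℝ) (hpr : Pseudorandom E p r) :
    ∀ A B : Finset (Fin n), Disjoint A B → A.Nonempty → B.Nonempty → A.card ≤ B.card →
      |(eG E A B : ℝ) - p * A.card * B.card| ≤ r * B.card * Real.sqrt (p * n) := by
  intro A B hAB hA _ hle
  have hdisc : ∀ S : Finset (Fin n),
      ∑ x ∈ S, ((eG E A {x} : ℝ) - p * A.card) = eG E A S - p * A.card * S.card := by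
    intro S
    rw [eG_eq_sum_singleton E A S, Finset.sum_sub_distrib, Finset.sum_const, nsmul_eq_mul]
    push_cast
    ring
  have key := Finset.abs_sum_le_card_mul_of_forall_card_eq
    (fun x => (eG E A {x} : ℝ) - p * A.card) (r * Real.sqrt (p * n)) hA.card_pos B hle ?_
  · rw [hdisc] at key
    linarith
  · intro S hS hcard
    rw [hdisc]
    linarith [hpr.2 A S (hAB.mono_right hS) hcard.symm]
end
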